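/- arXiv:1203.4124 — 3 statements merged into one kernel-verified Lean document; each statement's English description precedes it below -/
import Mathlib

section
/- Let p ≥ 2 and let K, B₁, B₂ > 0. There exists a constant C > 0, depending only on p, K, B₁ and B₂, with the following property: for every real Banach space B with modulus of uniform convexity η(ε) = K ε^p, every linear operator T on B satisfying B₁ ‖y‖ ≤ ‖Tⁿ y‖ ≤ B₂ ‖y‖ for every n ∈ ℕ and every y ∈ B, every x ∈ B, and every strictly increasing sequence (t_k)_{k∈ℕ} of positive integers, one has ∑_k ‖A_{t_{k+1}} x − A_{t_k} x‖^p ≤ C ‖x‖^p. -/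
open Finset

/-- The ergodic averages `A n x = (1/n) ∑_{i<n} Tⁱ x`. -/
noncomputable def ergAvg {B : Type*} [NormedAddCommGroup B] [Module ℝ B]
    (T : B →ₗ[ℝ] B) (n : ℕ) (x : B) : B :=
  (n : ℝ)⁻¹ • ∑ i ∈ Finset.range n, (T ^ i) x

/-- Clarkson's inequality for two nonnegative reals. -/
lemma clarkson_real {p a b : ℝ} (hp : 2 ≤ p) (hb : 0 ≤ b) (hba : b ≤ a) :
    ((a + b) / 2) ^ p + ((a - b) / 2) ^ p ≤ (a ^ p + b ^ p) / 2 := by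
  have ha : 0 ≤ a := hb.trans hba
  have hq : 1 ≤ p / 2 := by linarith
  have sq_rpow : ∀ z : ℝ, 0 ≤ z → (z ^ 2) ^ (p / 2) = z ^ p := fun z hz => by
    rw [← Real.rpow_natCast, ← Real.rpow_mul hz]
    congr 1
    push_cast
    ring
  have hsuper := Real.add_rpow_le_rpow_add (sq_nonneg ((a + b) / 2)) (sq_nonneg ((a - b) / 2)) hq
  have hconv := (convexOn_rpow hq).2 (Set.mem_Ici.mpr (sq_nonneg a))
    (Set.mem_Ici.mpr (sq_nonneg b)) (by norm_num : (0 : ℝ) ≤ 1 / 2)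
    (by norm_num : (0 : ℝ) ≤ 1 / 2) (by norm_num)
  simp only [smul_eq_mul] at hconv
  rw [sq_rpow _ (by linarith), sq_rpow _ (by linarith)] at hsuper
  rw [sq_rpow _ ha, sq_rpow _ hb] at hconv
  have hid : ((a + b) / 2) ^ 2 + ((a - b) / 2) ^ 2 = 1 / 2 * a ^ 2 + 1 / 2 * b ^ 2 := by ring
  rw [hid] at hsuper
  linarith

/-- If the norm has modulus of uniform convexity `K ε ^ p`, then `‖·‖ ^ p` is uniformly midpoint
convex, here for vectors the larger of which is a unit vector. -/
lemma uniform_midpoint_of_unit {p K : ℝ} (hp : 2 ≤ p) (hK : 0 < K)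
    {B : Type*} [NormedAddCommGroup B] [NormedSpace ℝ B]
    (huc : ∀ ε ∈ Set.Ioc (0 : ℝ) 2, ∀ x y : B, ‖x‖ ≤ 1 → ‖y‖ ≤ 1 → ε ≤ ‖x - y‖ →
      ‖(1 / 2 : ℝ) • (x + y)‖ ≤ 1 - K * ε ^ p) (u v : B) (hu : ‖u‖ = 1) (hv : ‖v‖ ≤ 1) :
    ‖(1 / 2 : ℝ) • (u + v)‖ ^ p + min ((1 / 8) ^ p) (K / 4 * (1 / 4) ^ p) * ‖u - v‖ ^ p ≤
      (‖u‖ ^ p + ‖v‖ ^ p) / 2 := by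
  have hp0 : 0 ≤ p := by linarith
  have hp1 : 1 ≤ p := by linarith
  set r := ‖v‖ with hr
  set ε := ‖u - v‖ with hε
  have hr0 : 0 ≤ r := norm_nonneg v
  have hε0 : 0 ≤ ε := norm_nonneg _
  have hε2 : ε ≤ 2 := by
    have := norm_sub_le u v
    linarith
  have hεp : 0 ≤ ε ^ p := Real.rpow_nonneg hε0 p
  have hclark := clarkson_real hp hr0 hv
  have hnorm : ∀ w : B, ‖(1 / 2 : ℝ) • w‖ = ‖w‖ / 2 := fun w => by
    rw [norm_smul]
    norm_num
    ring
  rw [Real.one_rpow] at hclark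
  rw [hu, Real.one_rpow]
  by_cases hgap : ε / 4 ≤ 1 - r
  · have hmid : ‖(1 / 2 : ℝ) • (u + v)‖ ^ p ≤ ((1 + r) / 2) ^ p := by
      refine Real.rpow_le_rpow (norm_nonneg _) ?_ hp0
      rw [hnorm]
      have := norm_add_le u v
      linarith
    have hdiff : (1 / 8) ^ p * ε ^ p ≤ ((1 - r) / 2) ^ p := by
      rw [← Real.mul_rpow (by norm_num) hε0]
      exact Real.rpow_le_rpow (by positivity) (by linarith) hp0
    have := mul_le_mul_of_nonneg_right (min_le_left ((1 / 8 : ℝ) ^ p) (K / 4 * (1 / 4) ^ p)) hεp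
    linarith
  · push Not at hgap
    have hr2 : 1 / 2 < r := by linarith
    have hrpos : 0 < r := by linarith
    have hε' : 0 < ε := by linarith
    set v' := r⁻¹ • v with hv'
    have hvv : v = r • v' := by rw [hv', smul_smul, mul_inv_cancel₀ hrpos.ne', one_smul]
    have hv'1 : ‖v'‖ = 1 := by
      rw [hv', norm_smul, norm_inv, Real.norm_of_nonneg hr0, ← hr, inv_mul_cancel₀ hrpos.ne']
    have hvdist : ‖v' - v‖ = 1 - r := by
      have : v' - v = (1 - r) • v' := by rw [sub_smul, one_smul, ← hvv]
      rw [this, norm_smul, hv'1, mul_one, Real.norm_of_nonneg (by linarith)]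
    have hsep : ε / 2 ≤ ‖u - v'‖ := by
      have := norm_sub_le_norm_sub_add_norm_sub u v' v
      linarith
    have hmid' := huc (ε / 2) ⟨by linarith, by linarith⟩ u v' hu.le hv'1.le hsep
    set κ := r * (K * (ε / 2) ^ p) with hκ
    have hκ0 : 0 ≤ κ := by positivity
    have hmid : ‖(1 / 2 : ℝ) • (u + v)‖ ≤ (1 + r) / 2 - κ := by
      have hsplit : (1 / 2 : ℝ) • (u + v) =
          r • ((1 / 2 : ℝ) • (u + v')) + ((1 - r) / 2) • u := by
        rw [hvv]
        module
      calc ‖(1 / 2 : ℝ) • (u + v)‖ ≤ r * ‖(1 / 2 : ℝ) • (u + v')‖ + (1 - r) / 2 := by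
            rw [hsplit]
            refine (norm_add_le _ _).trans ?_
            rw [norm_smul, norm_smul _ u, hu, Real.norm_of_nonneg hr0,
              Real.norm_of_nonneg (by linarith : 0 ≤ (1 - r) / 2), mul_one]
        _ ≤ r * (1 - K * (ε / 2) ^ p) + (1 - r) / 2 := by gcongr
        _ = (1 + r) / 2 - κ := by rw [hκ]; ring
    set x := (1 + r) / 2 with hx
    have hxpos : 0 < x := by linarith
    have hx1 : x ≤ 1 := by linarith
    have hx2 : 1 / 2 ≤ x := by linarith
    have hq0 : 0 ≤ 1 - κ / x := by
      rw [sub_nonneg, div_le_one hxpos]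
      linarith [norm_nonneg ((1 / 2 : ℝ) • (u + v))]
    have hq1 : 1 - κ / x ≤ 1 := by
      have : 0 ≤ κ / x := by positivity
      linarith
    have hpow : ‖(1 / 2 : ℝ) • (u + v)‖ ^ p ≤ x ^ p - x ^ p * κ := by
      have hfac : x - κ = x * (1 - κ / x) := by field_simp
      calc ‖(1 / 2 : ℝ) • (u + v)‖ ^ p ≤ (x - κ) ^ p :=
            Real.rpow_le_rpow (norm_nonneg _) hmid hp0
        _ = x ^ p * (1 - κ / x) ^ p := by rw [hfac, Real.mul_rpow hxpos.le hq0]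
        _ ≤ x ^ p * (1 - κ / x) := by
            gcongr
            exact Real.rpow_le_self_of_le_one hq0 hq1 hp1
        _ ≤ x ^ p * (1 - κ) := by
            gcongr
            exact le_div_self hκ0 hxpos hx1
        _ = x ^ p - x ^ p * κ := by ring
    have hxp : (1 / 2) ^ p ≤ x ^ p := Real.rpow_le_rpow (by norm_num) hx2 hp0
    have hgain : min ((1 / 8 : ℝ) ^ p) (K / 4 * (1 / 4) ^ p) * ε ^ p ≤ x ^ p * κ := by
      calc min ((1 / 8 : ℝ) ^ p) (K / 4 * (1 / 4) ^ p) * ε ^ p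
          ≤ K / 4 * (1 / 4) ^ p * ε ^ p := by
            gcongr
            exact min_le_right _ _
        _ = (1 / 2) ^ p * (1 / 4 * (K * (ε / 2) ^ p)) := by
            have : (1 / 4 : ℝ) ^ p * ε ^ p = (1 / 2) ^ p * (ε / 2) ^ p := by
              rw [← Real.mul_rpow (by norm_num) hε0, ← Real.mul_rpow (by norm_num) (by positivity)]
              congr 1
              ring
            linear_combination K / 4 * this
        _ ≤ x ^ p * κ := by
            rw [hκ]
            gcongr
            linarith
    have hclark' : x ^ p ≤ (1 + r ^ p) / 2 := by
      have : 0 ≤ ((1 - r) / 2) ^ p := Real.rpow_nonneg (by linarith) p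
      linarith
    linarith

/-- A norm with modulus of uniform convexity `K ε ^ p` makes `‖·‖ ^ p` uniformly midpoint
convex. -/
lemma uniform_midpoint {p K : ℝ} (hp : 2 ≤ p) (hK : 0 < K)
    {B : Type*} [NormedAddCommGroup B] [NormedSpace ℝ B]
    (huc : ∀ ε ∈ Set.Ioc (0 : ℝ) 2, ∀ x y : B, ‖x‖ ≤ 1 → ‖y‖ ≤ 1 → ε ≤ ‖x - y‖ →
      ‖(1 / 2 : ℝ) • (x + y)‖ ≤ 1 - K * ε ^ p) (u v : B) :
    ‖(1 / 2 : ℝ) • (u + v)‖ ^ p + min ((1 / 8) ^ p) (K / 4 * (1 / 4) ^ p) * ‖u - v‖ ^ p ≤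
      (‖u‖ ^ p + ‖v‖ ^ p) / 2 := by
  wlog huv : ‖v‖ ≤ ‖u‖ generalizing u v
  · have := this v u (le_of_not_ge huv)
    rwa [add_comm v u, norm_sub_rev v u, add_comm (‖v‖ ^ p)] at this
  rcases eq_or_ne u 0 with rfl | hu
  · have hv : v = 0 := by simpa using huv
    have : p ≠ 0 := by linarith
    simp [hv, Real.zero_rpow this]
  have hpos : 0 < ‖u‖ := norm_pos_iff.mpr hu
  have scale : ∀ w : B, ‖w‖ ^ p = ‖u‖ ^ p * ‖‖u‖⁻¹ • w‖ ^ p := fun w => by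
    rw [← Real.mul_rpow hpos.le (norm_nonneg _), norm_smul, norm_inv, norm_norm,
      mul_inv_cancel_left₀ hpos.ne']
  have key := uniform_midpoint_of_unit hp hK huc (‖u‖⁻¹ • u) (‖u‖⁻¹ • v)
    (by rw [norm_smul, norm_inv, norm_norm, inv_mul_cancel₀ hpos.ne'])
    (by rw [norm_smul, norm_inv, norm_norm, inv_mul_le_one₀ hpos]; exact huv)
  rw [scale u, scale v, scale (u - v), scale ((1 / 2 : ℝ) • (u + v)), smul_sub,
    smul_comm ‖u‖⁻¹ (1 / 2 : ℝ), smul_add]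
  have := mul_le_mul_of_nonneg_left key (Real.rpow_nonneg hpos.le p)
  linarith

/-- A `p`-homogeneous convex function that is uniformly midpoint convex with constant `c`: the
abstract properties of the `p`-th power of a `p`-uniformly convex norm. -/
structure IsUniformGauge {B : Type*} [AddCommGroup B] [Module ℝ B] (p c : ℝ) (Φ : B → ℝ) :
    Prop where
  nonneg : ∀ x, 0 ≤ Φ x
  map_smul : ∀ (a : ℝ) (x : B), Φ (a • x) = |a| ^ p * Φ x
  convexOn : ConvexOn ℝ Set.univ Φ
  midpoint : ∀ u v : B, Φ ((1 / 2 : ℝ) • (u + v)) + c * Φ (u - v) ≤ (Φ u + Φ v) / 2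

/-- A power bounded operator that is also power bounded from below is a contraction for a uniform
gauge equivalent to `‖·‖ ^ p`. -/
lemma exists_invariant_gauge {p c B₁ B₂ : ℝ} (hp : 1 ≤ p) (hB₁ : 0 < B₁)
    {B : Type*} [NormedAddCommGroup B] [NormedSpace ℝ B]
    (hmid : ∀ u v : B, ‖(1 / 2 : ℝ) • (u + v)‖ ^ p + c * ‖u - v‖ ^ p ≤ (‖u‖ ^ p + ‖v‖ ^ p) / 2)
    (T : B →ₗ[ℝ] B)
    (hT : ∀ (n : ℕ) (y : B), B₁ * ‖y‖ ≤ ‖(T ^ n) y‖ ∧ ‖(T ^ n) y‖ ≤ B₂ * ‖y‖) :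
    ∃ Φ : B → ℝ, IsUniformGauge p c Φ ∧ (∀ x, Φ (T x) ≤ Φ x) ∧
      ∀ x, (B₁ * ‖x‖) ^ p ≤ Φ x ∧ Φ x ≤ (B₂ * ‖x‖) ^ p := by
  have hp0 : 0 ≤ p := by linarith
  set avg : B → ℕ → ℝ := fun x n => ((n : ℝ) + 1)⁻¹ * ∑ i ∈ range (n + 1), ‖(T ^ i) x‖ ^ p
    with havg
  have hbound : ∀ x n, avg x n ∈ Set.Icc ((B₁ * ‖x‖) ^ p) ((B₂ * ‖x‖) ^ p) := by
    intro x n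
    have hlow : ∑ _i ∈ range (n + 1), (B₁ * ‖x‖) ^ p ≤ ∑ i ∈ range (n + 1), ‖(T ^ i) x‖ ^ p :=
      sum_le_sum fun i _ => Real.rpow_le_rpow (by positivity) (hT i x).1 hp0
    have hupp : ∑ i ∈ range (n + 1), ‖(T ^ i) x‖ ^ p ≤ ∑ _i ∈ range (n + 1), (B₂ * ‖x‖) ^ p :=
      sum_le_sum fun i _ => Real.rpow_le_rpow (norm_nonneg _) (hT i x).2 hp0
    simp only [sum_const, card_range, nsmul_eq_mul, Nat.cast_add, Nat.cast_one] at hlow hupp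
    have hn : (0 : ℝ) < (n : ℝ) + 1 := by positivity
    exact ⟨(le_inv_mul_iff₀ hn).mpr hlow, (inv_mul_le_iff₀ hn).mpr hupp⟩
  have hlim : ∀ x, ∃ l ∈ Set.Icc ((B₁ * ‖x‖) ^ p) ((B₂ * ‖x‖) ^ p),
      Filter.Tendsto (avg x) (Filter.hyperfilter ℕ) (nhds l) := by
    intro x
    obtain ⟨l, hl, hle⟩ := (isCompact_Icc (a := (B₁ * ‖x‖) ^ p)
      (b := (B₂ * ‖x‖) ^ p)).ultrafilter_le_nhds ((Filter.hyperfilter ℕ).map (avg x))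
      (by
        rw [Ultrafilter.coe_map, Filter.le_principal_iff, Filter.mem_map]
        exact Filter.univ_mem' (hbound x))
    exact ⟨l, hl, hle⟩
  choose Φ hΦmem hΦ using hlim
  refine ⟨Φ, ⟨fun x => ?_, fun a x => ?_, ⟨convex_univ, fun x _ y _ a b ha hb hab => ?_⟩,
    fun u v => ?_⟩, fun x => ?_, fun x => hΦmem x⟩
  · exact (Real.rpow_nonneg (by positivity) p).trans (hΦmem x).1
  · refine tendsto_nhds_unique (hΦ (a • x)) (((hΦ x).const_mul (|a| ^ p)).congr fun n => ?_)
    simp only [havg, map_smul, norm_smul, Real.norm_eq_abs,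
      Real.mul_rpow (abs_nonneg a) (norm_nonneg _), ← mul_sum]
    ring
  · refine le_of_tendsto_of_tendsto' (hΦ _) (((hΦ x).const_mul a).add ((hΦ y).const_mul b))
      fun n => ?_
    have hpt : ∀ i ∈ range (n + 1), ‖(T ^ i) (a • x + b • y)‖ ^ p ≤
        a * ‖(T ^ i) x‖ ^ p + b * ‖(T ^ i) y‖ ^ p := by
      intro i _
      have hconv := (convexOn_rpow hp).2 (Set.mem_Ici.mpr (norm_nonneg ((T ^ i) x)))
        (Set.mem_Ici.mpr (norm_nonneg ((T ^ i) y))) ha hb hab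
      refine le_trans (Real.rpow_le_rpow (norm_nonneg _) ?_ hp0) hconv
      rw [map_add, map_smul, map_smul]
      refine (norm_add_le _ _).trans ?_
      rw [norm_smul, norm_smul, Real.norm_of_nonneg ha, Real.norm_of_nonneg hb]
      rfl
    have hsum := sum_le_sum hpt
    rw [sum_add_distrib, ← mul_sum, ← mul_sum] at hsum
    have := mul_le_mul_of_nonneg_left hsum (by positivity : 0 ≤ ((n : ℝ) + 1)⁻¹)
    simp only [havg]
    linarith
  · refine le_of_tendsto_of_tendsto' ((hΦ _).add ((hΦ (u - v)).const_mul c))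
      (((hΦ u).add (hΦ v)).div_const 2) fun n => ?_
    have hsum := sum_le_sum fun i (_ : i ∈ range (n + 1)) => hmid ((T ^ i) u) ((T ^ i) v)
    simp only [← map_add, ← map_sub, ← map_smul] at hsum
    rw [sum_add_distrib, ← mul_sum, ← sum_div, sum_add_distrib] at hsum
    have := mul_le_mul_of_nonneg_left hsum (by positivity : 0 ≤ ((n : ℝ) + 1)⁻¹)
    simp only [havg]
    linarith
  · have hzero : Filter.Tendsto (fun n : ℕ => ((n : ℝ) + 1)⁻¹ * (B₂ * ‖x‖) ^ p)
        (Filter.hyperfilter ℕ) (nhds 0) := by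
      have := (tendsto_one_div_add_atTop_nhds_zero_nat (𝕜 := ℝ)).mul_const ((B₂ * ‖x‖) ^ p)
      simp only [one_div, zero_mul] at this
      exact this.mono_left Nat.hyperfilter_le_atTop
    have hsum := (hΦ x).add hzero
    rw [add_zero] at hsum
    refine le_of_tendsto_of_tendsto' (hΦ (T x)) hsum fun n => ?_
    have hshift : ∑ i ∈ range (n + 1), ‖(T ^ i) (T x)‖ ^ p ≤
        ∑ i ∈ range (n + 1), ‖(T ^ i) x‖ ^ p + (B₂ * ‖x‖) ^ p := by
      have hrw : ∀ i, (T ^ i) (T x) = (T ^ (i + 1)) x := fun i => by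
        rw [pow_succ, Module.End.mul_apply]
      simp only [hrw]
      have h1 := sum_range_succ (fun i => ‖(T ^ i) x‖ ^ p) (n + 1)
      have h2 := sum_range_succ' (fun i => ‖(T ^ i) x‖ ^ p) (n + 1)
      have h3 : ‖(T ^ (n + 1)) x‖ ^ p ≤ (B₂ * ‖x‖) ^ p :=
        Real.rpow_le_rpow (norm_nonneg _) (hT _ x).2 hp0
      have h4 : 0 ≤ ‖(T ^ 0) x‖ ^ p := Real.rpow_nonneg (norm_nonneg _) p
      linarith
    have := mul_le_mul_of_nonneg_left hshift (by positivity : 0 ≤ ((n : ℝ) + 1)⁻¹)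
    simp only [havg]
    linarith

namespace IsUniformGauge

section Basic

variable {B : Type*} [AddCommGroup B] [Module ℝ B] {p c : ℝ} {Φ : B → ℝ}

lemma map_zero (hΦ : IsUniformGauge p c Φ) (hp : p ≠ 0) : Φ 0 = 0 := by
  have := hΦ.map_smul 0 0
  rwa [smul_zero, abs_zero, Real.zero_rpow hp, zero_mul] at this

lemma map_neg (hΦ : IsUniformGauge p c Φ) (x : B) : Φ (-x) = Φ x := by
  have := hΦ.map_smul (-1) x
  rwa [neg_one_smul, abs_neg, abs_one, Real.one_rpow, one_mul] at this

lemma map_sub_comm (hΦ : IsUniformGauge p c Φ) (x y : B) : Φ (x - y) = Φ (y - x) := by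
  rw [← neg_sub, hΦ.map_neg]

lemma midpoint_le (hΦ : IsUniformGauge p c Φ) (hc : 0 ≤ c) (x y : B) :
    Φ ((1 / 2 : ℝ) • (x + y)) ≤ (Φ x + Φ y) / 2 := by
  have := mul_nonneg hc (hΦ.nonneg (x - y))
  linarith [hΦ.midpoint x y]

lemma map_add_le (hΦ : IsUniformGauge p c Φ) (hc : 0 ≤ c) (x y : B) :
    Φ (x + y) ≤ 2 ^ p * (Φ x + Φ y) := by
  have hxy : x + y = (2 : ℝ) • ((1 / 2 : ℝ) • (x + y)) := by module
  rw [hxy, hΦ.map_smul, abs_of_pos (by norm_num : (0 : ℝ) < 2)]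
  have := hΦ.midpoint_le hc x y
  gcongr
  linarith [hΦ.nonneg x, hΦ.nonneg y]

lemma map_sub_le (hΦ : IsUniformGauge p c Φ) (hc : 0 ≤ c) (x y : B) :
    Φ (x - y) ≤ 2 ^ p * (Φ x + Φ y) := by
  rw [sub_eq_add_neg, ← hΦ.map_neg y]
  exact hΦ.map_add_le hc x (-y)

/-- Subadditivity of the perspective of `Φ`. -/
lemma perspective_add_le (hΦ : IsUniformGauge p c Φ) (m n : ℕ) (X Y : B)
    (hX : m = 0 → X = 0) (hY : n = 0 → Y = 0) :
    ((m + n : ℕ) : ℝ) * Φ (((m + n : ℕ) : ℝ)⁻¹ • (X + Y)) ≤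
      m * Φ ((m : ℝ)⁻¹ • X) + n * Φ ((n : ℝ)⁻¹ • Y) := by
  rcases Nat.eq_zero_or_pos m with rfl | hm
  · simp [hX rfl]
  rcases Nat.eq_zero_or_pos n with rfl | hn
  · simp [hY rfl]
  have hm' : (0 : ℝ) < m := by exact_mod_cast hm
  have hn' : (0 : ℝ) < n := by exact_mod_cast hn
  have hmn : (0 : ℝ) < m + n := by positivity
  have hconv := hΦ.convexOn.2 (Set.mem_univ ((m : ℝ)⁻¹ • X)) (Set.mem_univ ((n : ℝ)⁻¹ • Y))
    (by positivity : 0 ≤ (m : ℝ) / (m + n)) (by positivity : 0 ≤ (n : ℝ) / (m + n))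
    (by field_simp)
  have hcomb : ((m : ℝ) / (m + n)) • (m : ℝ)⁻¹ • X + ((n : ℝ) / (m + n)) • (n : ℝ)⁻¹ • Y =
      ((m + n : ℕ) : ℝ)⁻¹ • (X + Y) := by
    rw [smul_smul, smul_smul, smul_add]
    push_cast
    congr 2 <;> field_simp
  rw [hcomb] at hconv
  have := mul_le_mul_of_nonneg_left hconv hmn.le
  simp only [smul_eq_mul] at this
  calc ((m + n : ℕ) : ℝ) * Φ (((m + n : ℕ) : ℝ)⁻¹ • (X + Y))
      ≤ (m + n) * ((m : ℝ) / (m + n) * Φ ((m : ℝ)⁻¹ • X) +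
          (n : ℝ) / (m + n) * Φ ((n : ℝ)⁻¹ • Y)) := by
        rw [Nat.cast_add]
        rwa [Nat.cast_add] at this
    _ = m * Φ ((m : ℝ)⁻¹ • X) + n * Φ ((n : ℝ)⁻¹ • Y) := by field_simp

lemma perspective_sum_le (hΦ : IsUniformGauge p c Φ) (n : ℕ) (w : ℕ → B) :
    (n : ℝ) * Φ ((n : ℝ)⁻¹ • ∑ i ∈ range n, w i) ≤ ∑ i ∈ range n, Φ (w i) := by
  induction n with
  | zero => simp
  | succ n ih =>
    rw [sum_range_succ, sum_range_succ]
    have := hΦ.perspective_add_le n 1 (∑ i ∈ range n, w i) (w n) (by rintro rfl; simp) (by simp)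
    simp only [Nat.cast_one, inv_one, one_smul, one_mul] at this
    linarith

lemma map_pow_le {S : B →ₗ[ℝ] B} (hS : ∀ x, Φ (S x) ≤ Φ x) (n : ℕ) (x : B) :
    Φ ((S ^ n) x) ≤ Φ x := by
  induction n with
  | zero => simp
  | succ n ih =>
    rw [pow_succ', Module.End.mul_apply]
    exact (hS _).trans ih

end Basic

variable {B : Type*} [NormedAddCommGroup B] [Module ℝ B] {p c : ℝ} {Φ : B → ℝ}

/-- Displacements by at most half the averaging length are controlled by the drop of `Φ` under
averaging. -/
lemma displacement_le_of_two_mul_le (hΦ : IsUniformGauge p c Φ) (hc : 0 ≤ c) {S : B →ₗ[ℝ] B}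
    (hS : ∀ x, Φ (S x) ≤ Φ x) (g : B) {d s : ℕ} (hds : 2 * d ≤ s) (hs : 0 < s) :
    c * Φ (g - (S ^ d) g) ≤ 2 * (Φ g - Φ (ergAvg S s g)) := by
  obtain ⟨e, rfl⟩ : ∃ e, s = e + d := ⟨s - d, by omega⟩
  set near : ℕ → B := fun i => (1 / 2 : ℝ) • ((S ^ i) g + (S ^ (d + i)) g)
  set far : ℕ → B := fun i => (1 / 2 : ℝ) • ((S ^ i) g + (S ^ (e + i)) g)
  have hsplit : ∑ i ∈ range (e + d), (S ^ i) g =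
      ∑ i ∈ range e, near i + ∑ i ∈ range d, far i := by
    have h1 := sum_range_add (fun i => (S ^ i) g) e d
    have h2 := sum_range_add (fun i => (S ^ i) g) d e
    rw [add_comm d e] at h2
    simp only [near, far, ← smul_sum, sum_add_distrib]
    have h3 : ∑ i ∈ range (e + d), (S ^ i) g = (1 / 2 : ℝ) •
        (∑ i ∈ range (e + d), (S ^ i) g + ∑ i ∈ range (e + d), (S ^ i) g) := by module
    rw [h3]
    nth_rewrite 1 [h1]
    rw [h2]
    module
  have hnear : ∀ i ∈ range e, Φ (near i) ≤ Φ g - c * Φ (g - (S ^ d) g) := by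
    intro i _
    have hfac : near i = (S ^ i) ((1 / 2 : ℝ) • (g + (S ^ d) g)) := by
      simp only [near]
      rw [add_comm d i, pow_add, Module.End.mul_apply, LinearMap.map_smul, LinearMap.map_add]
    rw [hfac]
    refine (map_pow_le hS i _).trans ?_
    linarith [hΦ.midpoint g ((S ^ d) g), map_pow_le hS d g]
  have hfar : ∀ i ∈ range d, Φ (far i) ≤ Φ g := by
    intro i _
    linarith [hΦ.midpoint_le hc ((S ^ i) g) ((S ^ (e + i)) g), map_pow_le hS i g,
      map_pow_le hS (e + i) g]
  have hjensen : ((e + d : ℕ) : ℝ) * Φ (ergAvg S (e + d) g) ≤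
      e * (Φ g - c * Φ (g - (S ^ d) g)) + d * Φ g := by
    rw [ergAvg, hsplit]
    refine (hΦ.perspective_add_le e d _ _ (by rintro rfl; simp) (by rintro rfl; simp)).trans ?_
    have h1 := (hΦ.perspective_sum_le e near).trans (sum_le_sum hnear)
    have h2 := (hΦ.perspective_sum_le d far).trans (sum_le_sum hfar)
    simp only [sum_const, card_range, nsmul_eq_mul] at h1 h2
    linarith
  have hed : (d : ℝ) ≤ e := by exact_mod_cast (by omega : d ≤ e)
  have hpos : (0 : ℝ) < (e : ℝ) + d := by exact_mod_cast hs
  have hnn : 0 ≤ c * Φ (g - (S ^ d) g) := mul_nonneg hc (hΦ.nonneg _)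
  rw [Nat.cast_add] at hjensen
  refine le_of_mul_le_mul_left ?_ hpos
  nlinarith [mul_le_mul_of_nonneg_right hed hnn]

lemma displacement_le (hΦ : IsUniformGauge p c Φ) (hc : 0 ≤ c) {S : B →ₗ[ℝ] B}
    (hS : ∀ x, Φ (S x) ≤ Φ x) (g : B) {d s : ℕ} (hds : d < s) :
    c * Φ (g - (S ^ d) g) ≤ 2 ^ p * 4 * (Φ g - Φ (ergAvg S s g)) := by
  obtain ⟨a, b, rfl, ha, hb⟩ : ∃ a b, d = a + b ∧ 2 * a ≤ s ∧ 2 * b ≤ s :=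
    ⟨d / 2, d - d / 2, by omega, by omega, by omega⟩
  have h1 := hΦ.displacement_le_of_two_mul_le hc hS g ha (by omega)
  have h2 := hΦ.displacement_le_of_two_mul_le hc hS g hb (by omega)
  have hsplit : g - (S ^ (a + b)) g = (g - (S ^ a) g) + (S ^ a) (g - (S ^ b) g) := by
    rw [pow_add, Module.End.mul_apply, LinearMap.map_sub]
    abel
  have h3 : c * Φ (g - (S ^ (a + b)) g) ≤
      c * (2 ^ p * (Φ (g - (S ^ a) g) + Φ (g - (S ^ b) g))) := by
    rw [hsplit]
    refine mul_le_mul_of_nonneg_left ((hΦ.map_add_le hc _ _).trans ?_) hc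
    have := map_pow_le hS a (g - (S ^ b) g)
    gcongr
  have h4 : (0 : ℝ) ≤ 2 ^ p := by positivity
  nlinarith [mul_le_mul_of_nonneg_left (add_le_add h1 h2) h4]

lemma map_pow_sub_ergAvg_le (hΦ : IsUniformGauge p c Φ) (hc : 0 ≤ c) {S : B →ₗ[ℝ] B}
    (hS : ∀ x, Φ (S x) ≤ Φ x) (g : B) {q s : ℕ} (hqs : q < s) :
    c * Φ ((S ^ q) g - ergAvg S s g) ≤ 2 ^ p * 2 ^ p * 8 * (Φ g - Φ (ergAvg S s g)) := by
  have hs : (0 : ℝ) < s := by exact_mod_cast (by omega : 0 < s)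
  have hrepr : (S ^ q) g - ergAvg S s g =
      (s : ℝ)⁻¹ • ∑ i ∈ range s, ((S ^ q) g - (S ^ i) g) := by
    rw [sum_sub_distrib, sum_const, card_range, smul_sub, ← Nat.cast_smul_eq_nsmul ℝ, smul_smul,
      inv_mul_cancel₀ hs.ne', one_smul, ergAvg]
  have hterm : ∀ i ∈ range s, c * Φ ((S ^ q) g - (S ^ i) g) ≤
      2 ^ p * 2 ^ p * 8 * (Φ g - Φ (ergAvg S s g)) := by
    intro i hi
    have h1 := hΦ.displacement_le hc hS g hqs
    have h2 := hΦ.displacement_le hc hS g (mem_range.mp hi)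
    have hsplit : (S ^ q) g - (S ^ i) g = (g - (S ^ i) g) - (g - (S ^ q) g) := by abel
    have h3 := mul_le_mul_of_nonneg_left (hΦ.map_sub_le hc (g - (S ^ i) g) (g - (S ^ q) g)) hc
    rw [← hsplit] at h3
    have h4 : (0 : ℝ) ≤ 2 ^ p := by positivity
    nlinarith [mul_le_mul_of_nonneg_left (add_le_add h1 h2) h4]
  have hjensen := mul_le_mul_of_nonneg_left
    (hΦ.perspective_sum_le s fun i => (S ^ q) g - (S ^ i) g) hc
  rw [← hrepr, mul_sum] at hjensen
  have hsum := hjensen.trans (sum_le_sum hterm)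
  rw [sum_const, card_range, nsmul_eq_mul] at hsum
  refine le_of_mul_le_mul_left ?_ hs
  linarith

lemma map_ergAvg_le (hΦ : IsUniformGauge p c Φ) {S : B →ₗ[ℝ] B}
    (hS : ∀ x, Φ (S x) ≤ Φ x) (g : B) {s : ℕ} (hs : 0 < s) : Φ (ergAvg S s g) ≤ Φ g := by
  have hs' : (0 : ℝ) < s := by exact_mod_cast hs
  have h := (hΦ.perspective_sum_le s fun i => (S ^ i) g).trans
    (sum_le_sum fun i _ => map_pow_le hS i g)
  rw [sum_const, card_range, nsmul_eq_mul] at h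
  exact le_of_mul_le_mul_left h hs'

end IsUniformGauge

lemma sum_range_mul_pow_apply {B : Type*} [AddCommGroup B] [Module ℝ B] (T : B →ₗ[ℝ] B)
    (a b : ℕ) (f : B) :
    ∑ i ∈ range (a * b), (T ^ i) f = ∑ j ∈ range b, ((T ^ a) ^ j) (∑ i ∈ range a, (T ^ i) f) := by
  induction b with
  | zero => simp
  | succ b ih =>
    rw [Nat.mul_succ, sum_range_add, ih, sum_range_succ]
    simp only [pow_add, Module.End.mul_apply, ← map_sum, ← pow_mul]

lemma ergAvg_mul {B : Type*} [NormedAddCommGroup B] [Module ℝ B] (T : B →ₗ[ℝ] B)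
    (a b : ℕ) (f : B) : ergAvg T (a * b) f = ergAvg (T ^ a) b (ergAvg T a f) := by
  simp only [ergAvg, sum_range_mul_pow_apply, map_smul, ← smul_sum, smul_smul]
  congr 1
  push_cast
  rw [mul_inv, mul_comm]

/-- A subadditive interval function is bounded by its values on aligned dyadic intervals: every
interval splits into such pieces, at most two of each length. -/
lemma interval_le_dyadic (V : ℕ → ℕ → ℝ) (N : ℕ) (β : ℕ → ℝ) (hβ : ∀ j ≤ N, 0 ≤ β j)
    (hself : ∀ t, V t t ≤ 0) (hadd : ∀ t s u, t ≤ s → s ≤ u → V t u ≤ V t s + V s u)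
    (hdyadic : ∀ j ≤ N, ∀ q, 2 ^ j * (q + 1) ≤ 2 ^ N → V (2 ^ j * q) (2 ^ j * (q + 1)) ≤ β j)
    {t s : ℕ} (hts : t ≤ s) (hs : s ≤ 2 ^ N) :
    V t s ≤ 2 * ∑ j ∈ range (N + 1), β j := by
  have main : ∀ k j, j + k = N → ∀ t s, t ≤ s → 2 ^ j * s ≤ 2 ^ N →
      V (2 ^ j * t) (2 ^ j * s) ≤ 2 * ∑ i ∈ range (k + 1), β (j + i) := by
    intro k
    induction k with
    | zero =>
      rintro j rfl t s hts hs
      have hs1 : s ≤ 1 := by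
        refine Nat.le_of_mul_le_mul_left ?_ (pow_pos two_pos j)
        simpa using hs
      have hβj := hβ j le_rfl
      rcases hts.eq_or_lt with rfl | hlt
      · have := hself (2 ^ j * t)
        simp
        linarith
      · obtain ⟨rfl, rfl⟩ : t = 0 ∧ s = 1 := by omega
        have := hdyadic j le_rfl 0 (by simp)
        simp at this ⊢
        linarith
    | succ k ih =>
      intro j hj t s hts hs
      rw [sum_range_succ', add_zero]
      have hβj := hβ j (by omega)
      have hrest : ∀ i ∈ range (k + 1), 0 ≤ β (j + (i + 1)) := fun i hi =>
        hβ _ (by have := mem_range.mp hi; omega)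
      have hrest' := sum_nonneg hrest
      by_cases hmid : (t + 1) / 2 ≤ s / 2
      · have hcoarse := ih (j + 1) (by omega) ((t + 1) / 2) (s / 2) hmid (by
          refine le_trans ?_ hs
          rw [pow_succ, mul_assoc]
          exact Nat.mul_le_mul_left _ (by omega))
        simp only [pow_succ, mul_assoc] at hcoarse
        have hidx : ∀ i, j + 1 + i = j + (i + 1) := fun i => by omega
        simp only [hidx] at hcoarse
        have hleft : V (2 ^ j * t) (2 ^ j * (2 * ((t + 1) / 2))) ≤ β j := by
          rcases Nat.even_or_odd' t with ⟨a, rfl | rfl⟩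
          · have : 2 * ((2 * a + 1) / 2) = 2 * a := by omega
            rw [this]
            exact (hself _).trans hβj
          · have : 2 * ((2 * a + 1 + 1) / 2) = 2 * a + 1 + 1 := by omega
            rw [this]
            exact hdyadic j (by omega) _ (le_trans (Nat.mul_le_mul_left _ (by omega)) hs)
        have hright : V (2 ^ j * (2 * (s / 2))) (2 ^ j * s) ≤ β j := by
          rcases Nat.even_or_odd' s with ⟨a, rfl | rfl⟩
          · have : 2 * (2 * a / 2) = 2 * a := by omega
            rw [this]
            exact (hself _).trans hβj
          · have : 2 * ((2 * a + 1) / 2) = 2 * a := by omega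
            rw [this]
            exact hdyadic j (by omega) _ hs
        have h1 := hadd (2 ^ j * t) (2 ^ j * (2 * ((t + 1) / 2))) (2 ^ j * s)
          (Nat.mul_le_mul_left _ (by omega)) (Nat.mul_le_mul_left _ (by omega))
        have h2 := hadd (2 ^ j * (2 * ((t + 1) / 2))) (2 ^ j * (2 * (s / 2))) (2 ^ j * s)
          (Nat.mul_le_mul_left _ (by omega)) (Nat.mul_le_mul_left _ (by omega))
        linarith
      · obtain rfl : t = s := by omega
        have := hself (2 ^ j * t)
        linarith
  have := main N 0 (by simp) t s hts (by simpa using hs)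
  simpa using this

/-- The increments of `a`, weighted dyadically and averaged up to scale `n`. -/
noncomputable def dyadicDrop (a : ℕ → ℝ) (n : ℕ) : ℝ :=
  (∑ i ∈ range (n + 1), 2 ^ i * (a i - a (i + 1))) / 2 ^ n

lemma sub_le_dyadicDrop {a : ℕ → ℝ} (ha : Antitone a) (n : ℕ) :
    a n - a (n + 1) ≤ dyadicDrop a n := by
  rw [dyadicDrop, le_div_iff₀ (by positivity), mul_comm]
  exact single_le_sum (f := fun i => 2 ^ i * (a i - a (i + 1)))
    (fun i _ => mul_nonneg (by positivity) (sub_nonneg.mpr (ha (Nat.le_succ i))))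
    (self_mem_range_succ n)

lemma dyadicDrop_nonneg {a : ℕ → ℝ} (ha : Antitone a) (n : ℕ) : 0 ≤ dyadicDrop a n :=
  (sub_nonneg.mpr (ha (Nat.le_succ n))).trans (sub_le_dyadicDrop ha n)

lemma sum_two_pow_mul_sub_le {a : ℕ → ℝ} (ha : Antitone a) (N : ℕ) :
    ∑ j ∈ range (N + 1), 2 ^ j * (a j - a N) ≤
      2 * ∑ i ∈ range N, 2 ^ i * (a i - a (i + 1)) := by
  induction N with
  | zero => simp
  | succ N ih =>
    have hgeom : ∑ j ∈ range (N + 1), (2 : ℝ) ^ j ≤ 2 * 2 ^ N := by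
      have := geom_sum_eq (by norm_num : (2 : ℝ) ≠ 1) (N + 1)
      rw [this, pow_succ]
      linarith
    have hstep : ∑ j ∈ range (N + 1 + 1), (2 : ℝ) ^ j * (a j - a (N + 1)) =
        ∑ j ∈ range (N + 1), 2 ^ j * (a j - a N) +
          (∑ j ∈ range (N + 1), (2 : ℝ) ^ j) * (a N - a (N + 1)) := by
      rw [sum_range_succ, sub_self, mul_zero, add_zero, sum_mul, ← sum_add_distrib]
      exact sum_congr rfl fun j _ => by ring
    rw [hstep, sum_range_succ (fun i => 2 ^ i * (a i - a (i + 1)))]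
    have := mul_le_mul_of_nonneg_right hgeom (sub_nonneg.mpr (ha (Nat.le_succ N)))
    linarith

lemma sum_dyadicDrop_le {a : ℕ → ℝ} (ha : Antitone a) (M : ℕ) :
    ∑ n ∈ range M, dyadicDrop a n ≤ 2 * (a 0 - a M) := by
  have key : ∑ n ∈ range M, dyadicDrop a n +
      2 * (∑ i ∈ range M, 2 ^ i * (a i - a (i + 1))) / 2 ^ M = 2 * (a 0 - a M) := by
    induction M with
    | zero => simp
    | succ M ih =>
      rw [sum_range_succ, dyadicDrop, sum_range_succ (fun i => 2 ^ i * (a i - a (i + 1)))]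
      have hpow : (0 : ℝ) < 2 ^ M := by positivity
      field_simp at ih ⊢
      linear_combination 2 ^ (M + 1) * ih
  have : 0 ≤ 2 * (∑ i ∈ range M, 2 ^ i * (a i - a (i + 1))) / 2 ^ M := by
    have := sum_nonneg fun i (_ : i ∈ range M) =>
      mul_nonneg (pow_nonneg zero_le_two i) (sub_nonneg.mpr (ha (Nat.le_succ i)))
    positivity
  linarith

/-- The density on `ℕ` spreading `dyadicDrop a n` evenly over `[2 ^ n, 2 ^ (n + 1))`. -/
noncomputable def dyadicDensity (a : ℕ → ℝ) (i : ℕ) : ℝ :=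
  dyadicDrop a (Nat.log 2 i) / 2 ^ Nat.log 2 i

lemma dyadicDensity_nonneg {a : ℕ → ℝ} (ha : Antitone a) (i : ℕ) : 0 ≤ dyadicDensity a i :=
  div_nonneg (dyadicDrop_nonneg ha _) (by positivity)

lemma sum_Ico_dyadicDensity (a : ℕ → ℝ) {n t s : ℕ} (ht : 2 ^ n ≤ t) (hts : t ≤ s)
    (hs : s ≤ 2 ^ (n + 1)) :
    ∑ i ∈ Ico t s, dyadicDensity a i = ((s : ℝ) - t) * (dyadicDrop a n / 2 ^ n) := by
  have hconst : ∀ i ∈ Ico t s, dyadicDensity a i = dyadicDrop a n / 2 ^ n := by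
    intro i hi
    rw [mem_Ico] at hi
    have hlog : Nat.log 2 i = n :=
      Nat.log_eq_of_pow_le_of_lt_pow (ht.trans hi.1) (hi.2.trans_le hs)
    rw [dyadicDensity, hlog]
  rw [sum_congr rfl hconst, sum_const, Nat.card_Ico, nsmul_eq_mul, Nat.cast_sub hts]

lemma sum_Ico_two_pow_dyadicDensity (a : ℕ → ℝ) {n m : ℕ} (hnm : n ≤ m) :
    ∑ i ∈ Ico (2 ^ n) (2 ^ m), dyadicDensity a i = ∑ k ∈ Ico n m, dyadicDrop a k := by
  induction m, hnm using Nat.le_induction with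
  | base => simp
  | succ m hnm ih =>
    rw [← sum_Ico_consecutive _ (Nat.pow_le_pow_right two_pos hnm)
      (Nat.pow_le_pow_right two_pos (Nat.le_add_right m 1)), ih, sum_Ico_succ_top hnm,
      sum_Ico_dyadicDensity a le_rfl (Nat.pow_le_pow_right two_pos (Nat.le_add_right m 1)) le_rfl]
    push_cast
    field_simp
    ring

namespace IsUniformGauge

variable {B : Type*} [NormedAddCommGroup B] [Module ℝ B] {p c : ℝ} {Φ : B → ℝ} {T : B →ₗ[ℝ] B}

lemma antitone_ergAvg_two_pow (hΦ : IsUniformGauge p c Φ) (hT : ∀ x, Φ (T x) ≤ Φ x) (f : B) :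
    Antitone fun j => Φ (ergAvg T (2 ^ j) f) :=
  antitone_nat_of_succ_le fun j => by
    rw [pow_succ, ergAvg_mul]
    exact hΦ.map_ergAvg_le (map_pow_le hT _) _ two_pos

lemma map_pow_ergAvg_sub_le (hΦ : IsUniformGauge p c Φ) (hc : 0 ≤ c)
    (hT : ∀ x, Φ (T x) ≤ Φ x) (f : B) {j N q : ℕ} (hj : j ≤ N) (hq : 2 ^ j * (q + 1) ≤ 2 ^ N) :
    c * Φ ((T ^ (2 ^ j * q)) (ergAvg T (2 ^ j) f) - ergAvg T (2 ^ N) f) ≤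
      2 ^ p * 2 ^ p * 8 * (Φ (ergAvg T (2 ^ j) f) - Φ (ergAvg T (2 ^ N) f)) := by
  have hN : 2 ^ N = 2 ^ j * 2 ^ (N - j) := by rw [← pow_add, Nat.add_sub_cancel' hj]
  rw [hN] at hq ⊢
  rw [ergAvg_mul, pow_mul]
  exact hΦ.map_pow_sub_ergAvg_le hc (map_pow_le hT _) _
    (Nat.le_of_mul_le_mul_left hq (pow_pos two_pos j))

/-- Averages over subintervals of `[0, 2 ^ N)` are close to `ergAvg T (2 ^ N) f`, with a loss
depending on the length of the interval. -/
lemma interval_average_le (hΦ : IsUniformGauge p c Φ) (hc : 0 < c)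
    (hT : ∀ x, Φ (T x) ≤ Φ x) (f : B) {N t s : ℕ} (hts : t ≤ s) (hs : s ≤ 2 ^ N) :
    c * (((s - t : ℕ) : ℝ) * Φ (((s - t : ℕ) : ℝ)⁻¹ •
      ∑ i ∈ Ico t s, ((T ^ i) f - ergAvg T (2 ^ N) f))) ≤
      2 ^ p * 2 ^ p * 32 * ∑ i ∈ range N,
        2 ^ i * (Φ (ergAvg T (2 ^ i) f) - Φ (ergAvg T (2 ^ (i + 1)) f)) := by
  set h := ergAvg T (2 ^ N) f with hh
  set a : ℕ → ℝ := fun j => Φ (ergAvg T (2 ^ j) f) with ha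
  have hanti : Antitone a := hΦ.antitone_ergAvg_two_pow hT f
  have hcover := interval_le_dyadic
    (fun t s => c * (((s - t : ℕ) : ℝ) * Φ (((s - t : ℕ) : ℝ)⁻¹ • ∑ i ∈ Ico t s, ((T ^ i) f - h))))
    N (fun j => 2 ^ p * 2 ^ p * 8 * (2 ^ j * (a j - a N)))
    (fun j hj => by
      have := sub_nonneg.mpr (hanti hj)
      positivity)
    (fun t => by simp)
    (fun t s u hts hsu => by
      have hlen : u - t = (s - t) + (u - s) := by omega
      rw [hlen, ← sum_Ico_consecutive _ hts hsu, ← mul_add]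
      refine mul_le_mul_of_nonneg_left (hΦ.perspective_add_le _ _ _ _ ?_ ?_) hc.le
      · intro h0
        rw [Ico_eq_empty_of_le (by omega), sum_empty]
      · intro h0
        rw [Ico_eq_empty_of_le (by omega), sum_empty])
    (fun j hj q hq => by
      have hlen : 2 ^ j * (q + 1) - 2 ^ j * q = 2 ^ j := by
        rw [mul_add, mul_one, Nat.add_sub_cancel_left]
      have hpos : ((2 ^ j : ℕ) : ℝ) ≠ 0 := by positivity
      have hrepr : ((2 ^ j : ℕ) : ℝ)⁻¹ •
          ∑ i ∈ Ico (2 ^ j * q) (2 ^ j * (q + 1)), ((T ^ i) f - h) =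
          (T ^ (2 ^ j * q)) (ergAvg T (2 ^ j) f) - h := by
        rw [sum_Ico_eq_sum_range, hlen, sum_sub_distrib, sum_const, card_range, smul_sub,
          ← Nat.cast_smul_eq_nsmul ℝ, smul_smul, inv_mul_cancel₀ hpos, one_smul, ergAvg,
          LinearMap.map_smul, map_sum]
        simp only [pow_add, Module.End.mul_apply]
      have := hΦ.map_pow_ergAvg_sub_le hc.le hT f hj hq
      simp only [hlen, hrepr]
      push_cast
      have := mul_le_mul_of_nonneg_left this (by positivity : (0 : ℝ) ≤ 2 ^ j)
      linarith)
    hts hs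
  rw [← mul_sum] at hcover
  have hsum := mul_le_mul_of_nonneg_left (sum_two_pow_mul_sub_le hanti N)
    (by positivity : (0 : ℝ) ≤ 2 ^ p * 2 ^ p * 8)
  simp only [ha] at hcover hsum ⊢
  linarith

/-- The variation of the averages inside a dyadic block. -/
lemma map_ergAvg_sub_le_of_block (hΦ : IsUniformGauge p c Φ) (hp : 2 ≤ p) (hc : 0 < c)
    (hT : ∀ x, Φ (T x) ≤ Φ x) (f : B) {n t s : ℕ} (ht : 2 ^ n ≤ t) (hts : t ≤ s)
    (hs : s ≤ 2 ^ (n + 1)) :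
    c * Φ (ergAvg T s f - ergAvg T t f) ≤ 2 ^ p * 2 ^ p * 2 ^ p * 64 *
      ∑ i ∈ Ico t s, dyadicDensity (fun j => Φ (ergAvg T (2 ^ j) f)) i := by
  rw [sum_Ico_dyadicDensity _ ht hts hs, dyadicDrop]
  rcases hts.eq_or_lt with rfl | hlt
  · rw [sub_self, hΦ.map_zero (by linarith)]
    simp
  set h := ergAvg T (2 ^ (n + 1)) f with hh
  set Q := ∑ i ∈ range (n + 1),
    2 ^ i * (Φ (ergAvg T (2 ^ i) f) - Φ (ergAvg T (2 ^ (i + 1)) f)) with hQ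
  have hV1 := hΦ.interval_average_le hc hT f hts hs
  have hV2 := hΦ.interval_average_le hc hT f (Nat.zero_le t) (hts.trans hs)
  rw [← hQ, ← hh] at hV1 hV2
  set X := ((s - t : ℕ) : ℝ)⁻¹ • ∑ i ∈ Ico t s, ((T ^ i) f - h) with hX
  set Y := ((t - 0 : ℕ) : ℝ)⁻¹ • ∑ i ∈ Ico 0 t, ((T ^ i) f - h) with hY
  have hδle : s - t ≤ t := by
    rw [pow_succ] at hs
    omega
  have ht0 : 0 < t := lt_of_lt_of_le (pow_pos two_pos n) ht
  have htR : (0 : ℝ) < t := by exact_mod_cast ht0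
  have hsR : (0 : ℝ) < s := by exact_mod_cast ht0.trans hlt
  have hδR : (0 : ℝ) < (s : ℝ) - t := by
    rw [sub_pos]
    exact_mod_cast hlt
  have hδt : (s : ℝ) - t ≤ t := by
    rw [← Nat.cast_sub hts]
    exact_mod_cast hδle
  rw [Nat.cast_sub hts] at hV1 hX
  rw [Nat.sub_zero] at hV2 hY
  have hrepr : ergAvg T s f - ergAvg T t f = (((s : ℝ) - t) / s) • (X - Y) := by
    have hsum : ∑ i ∈ range s, (T ^ i) f =
        ∑ i ∈ range t, (T ^ i) f + ∑ i ∈ Ico t s, (T ^ i) f := by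
      rw [range_eq_Ico, range_eq_Ico, sum_Ico_consecutive _ (Nat.zero_le t) hts]
    rw [hX, hY, sum_sub_distrib, sum_sub_distrib, sum_const, sum_const, Nat.card_Ico, Nat.card_Ico,
      ← Nat.cast_smul_eq_nsmul ℝ, ← Nat.cast_smul_eq_nsmul ℝ, Nat.sub_zero, Nat.cast_sub hts,
      ergAvg, ergAvg, hsum, ← range_eq_Ico]
    match_scalars <;> field_simp <;> ring
  have hratio0 : 0 ≤ ((s : ℝ) - t) / s := by positivity
  have hratio1 : ((s : ℝ) - t) / s ≤ 1 := by
    rw [div_le_one hsR]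
    linarith
  have hpow : (((s : ℝ) - t) / s) ^ p ≤ (((s : ℝ) - t) / s) ^ 2 := by
    rw [← Real.rpow_natCast]
    exact Real.rpow_le_rpow_of_exponent_ge (by positivity) hratio1 (by exact_mod_cast hp)
  set M := 2 ^ p * 2 ^ p * 32 * Q with hM
  have hX' : c * Φ X ≤ M / (s - t) := by
    rw [le_div_iff₀ hδR]
    linarith
  have hY' : c * Φ Y ≤ M / (s - t) := by
    rw [le_div_iff₀ hδR]
    have := mul_le_mul_of_nonneg_left hδt (mul_nonneg hc.le (hΦ.nonneg Y))
    linarith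
  have hM0 : 0 ≤ M := by
    have := mul_nonneg hδR.le (hΦ.nonneg X)
    exact (mul_nonneg hc.le this).trans hV1
  have hns : ((2 : ℝ) ^ n) ≤ s := by exact_mod_cast ht.trans hts
  have hsub := mul_le_mul_of_nonneg_left (hΦ.map_sub_le hc.le X Y) hc.le
  calc c * Φ (ergAvg T s f - ergAvg T t f)
      = (((s : ℝ) - t) / s) ^ p * (c * Φ (X - Y)) := by
        rw [hrepr, hΦ.map_smul, abs_of_nonneg hratio0]
        ring
    _ ≤ (((s : ℝ) - t) / s) ^ 2 * (2 ^ p * (M / (s - t) + M / (s - t))) := by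
        have hnn : 0 ≤ c * Φ (X - Y) := mul_nonneg hc.le (hΦ.nonneg _)
        refine mul_le_mul hpow ?_ hnn (by positivity)
        have := mul_le_mul_of_nonneg_left (add_le_add hX' hY')
          (by positivity : (0 : ℝ) ≤ 2 ^ p)
        linarith
    _ = 2 ^ p * 2 * M * (s - t) / s ^ 2 := by
        field_simp
        ring
    _ ≤ 2 ^ p * 2 * M * (s - t) / (2 ^ n) ^ 2 := by gcongr
    _ = 2 ^ p * 2 ^ p * 2 ^ p * 64 * ((s - t) * (Q / 2 ^ n / 2 ^ n)) := by
        rw [hM]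
        field_simp
        ring

/-- Any jump of the averages is controlled by the mass of the dyadic density in between. -/
lemma map_ergAvg_sub_le (hΦ : IsUniformGauge p c Φ) (hp : 2 ≤ p) (hc : 0 < c)
    (hT : ∀ x, Φ (T x) ≤ Φ x) (f : B) {t s : ℕ} (ht : 0 < t) (hts : t ≤ s) :
    c * Φ (ergAvg T s f - ergAvg T t f) ≤ 2 ^ p * 2 ^ p * (2 ^ p * 2 ^ p * 2 ^ p * 64) *
      ∑ i ∈ Ico t s, dyadicDensity (fun j => Φ (ergAvg T (2 ^ j) f)) i := by
  set a : ℕ → ℝ := fun j => Φ (ergAvg T (2 ^ j) f) with ha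
  have hanti : Antitone a := hΦ.antitone_ergAvg_two_pow hT f
  have hD : (1 : ℝ) ≤ 2 ^ p := Real.one_le_rpow (by norm_num) (by linarith)
  set D : ℝ := 2 ^ p with hDdef
  have hDD : 1 ≤ D * D := one_le_mul_of_one_le_of_one_le hD hD
  set n := Nat.log 2 t with hn
  set m := Nat.log 2 s with hm
  have hnt : 2 ^ n ≤ t := Nat.pow_log_le_self 2 ht.ne'
  have htn : t < 2 ^ (n + 1) := Nat.lt_pow_succ_log_self one_lt_two t
  have hms : 2 ^ m ≤ s := Nat.pow_log_le_self 2 (by omega)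
  have hsm : s < 2 ^ (m + 1) := Nat.lt_pow_succ_log_self one_lt_two s
  have hmass : ∀ u v, 0 ≤ ∑ i ∈ Ico u v, dyadicDensity a i := fun u v =>
    sum_nonneg fun i _ => dyadicDensity_nonneg hanti i
  have hnm_le : n ≤ m := Nat.log_mono_right hts
  rcases hnm_le.eq_or_lt with hnm | hnm
  · rw [← hnm] at hsm
    have := hΦ.map_ergAvg_sub_le_of_block hp hc hT f hnt hts hsm.le
    have h0 : 0 ≤ D * D * D * 64 * ∑ i ∈ Ico t s, dyadicDensity a i :=
      mul_nonneg (by positivity) (hmass t s)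
    nlinarith [mul_le_mul_of_nonneg_right hDD h0]
  · have hblocks : 2 ^ (n + 1) ≤ 2 ^ m := Nat.pow_le_pow_right two_pos hnm
    have h1 := hΦ.map_ergAvg_sub_le_of_block hp hc hT f hnt htn.le le_rfl
    have h3 := hΦ.map_ergAvg_sub_le_of_block hp hc hT f le_rfl hms hsm.le
    have h2 : c * Φ (ergAvg T (2 ^ m) f - ergAvg T (2 ^ (n + 1)) f) ≤
        D * D * D * 64 * ∑ i ∈ Ico (2 ^ (n + 1)) (2 ^ m), dyadicDensity a i := by
      have hpiece := hΦ.map_pow_ergAvg_sub_le hc.le hT f (q := 0) hnm (by simpa using hblocks)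
      rw [mul_zero, pow_zero, Module.End.one_apply, hΦ.map_sub_comm] at hpiece
      have htel : a (n + 1) - a m ≤ ∑ k ∈ Ico (n + 1) m, dyadicDrop a k := by
        have hsub := sum_Ico_sub a (Nat.succ_le_of_lt hnm)
        have hle := sum_le_sum fun k (_ : k ∈ Ico (n + 1) m) => sub_le_dyadicDrop hanti k
        rw [sum_sub_distrib] at hsub hle
        linarith
      rw [← sum_Ico_two_pow_dyadicDensity a hnm] at htel
      have h8 : D * D * 8 ≤ D * D * D * 64 := by nlinarith
      exact hpiece.trans (mul_le_mul h8 htel (sub_nonneg.mpr (hanti hnm)) (by positivity))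
    have hsplit : ergAvg T s f - ergAvg T t f =
        (ergAvg T s f - ergAvg T (2 ^ m) f) + ((ergAvg T (2 ^ m) f - ergAvg T (2 ^ (n + 1)) f) +
          (ergAvg T (2 ^ (n + 1)) f - ergAvg T t f)) := by abel
    have hΦsplit : Φ (ergAvg T s f - ergAvg T t f) ≤ D * D *
        (Φ (ergAvg T s f - ergAvg T (2 ^ m) f) + Φ (ergAvg T (2 ^ m) f - ergAvg T (2 ^ (n + 1)) f) +
          Φ (ergAvg T (2 ^ (n + 1)) f - ergAvg T t f)) := by
      rw [hsplit]
      refine (hΦ.map_add_le hc.le _ _).trans ?_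
      have hinner := hΦ.map_add_le hc.le (ergAvg T (2 ^ m) f - ergAvg T (2 ^ (n + 1)) f)
        (ergAvg T (2 ^ (n + 1)) f - ergAvg T t f)
      have hfirst := le_mul_of_one_le_left (hΦ.nonneg (ergAvg T s f - ergAvg T (2 ^ m) f)) hD
      rw [← hDdef] at hinner ⊢
      rw [mul_assoc]
      refine mul_le_mul_of_nonneg_left ?_ (by positivity)
      linarith
    have hmassSplit : ∑ i ∈ Ico t s, dyadicDensity a i =
        ∑ i ∈ Ico t (2 ^ (n + 1)), dyadicDensity a i +
          ∑ i ∈ Ico (2 ^ (n + 1)) (2 ^ m), dyadicDensity a i +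
          ∑ i ∈ Ico (2 ^ m) s, dyadicDensity a i := by
      rw [sum_Ico_consecutive _ htn.le hblocks, sum_Ico_consecutive _ (htn.le.trans hblocks) hms]
    have hscaled := mul_le_mul_of_nonneg_left hΦsplit hc.le
    have hsum := mul_le_mul_of_nonneg_left (add_le_add (add_le_add h3 h2) h1)
      (by positivity : (0 : ℝ) ≤ D * D)
    rw [hmassSplit]
    linarith

/-- The variational inequality for contractions of a uniform gauge. -/
lemma sum_map_ergAvg_sub_le (hΦ : IsUniformGauge p c Φ) (hp : 2 ≤ p) (hc : 0 < c)
    (hT : ∀ x, Φ (T x) ≤ Φ x) (f : B) {t : ℕ → ℕ} (hmono : Monotone t) (hpos : ∀ k, 0 < t k)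
    (m : ℕ) :
    c * ∑ k ∈ range m, Φ (ergAvg T (t (k + 1)) f - ergAvg T (t k) f) ≤
      2 ^ p * 2 ^ p * (2 ^ p * 2 ^ p * 2 ^ p * 64) * (2 * Φ f) := by
  set a : ℕ → ℝ := fun j => Φ (ergAvg T (2 ^ j) f) with ha
  have hanti : Antitone a := hΦ.antitone_ergAvg_two_pow hT f
  have ha0 : a 0 = Φ f := by simp [ha, ergAvg]
  have hmass : ∑ k ∈ range m, ∑ i ∈ Ico (t k) (t (k + 1)), dyadicDensity a i =
      ∑ i ∈ Ico (t 0) (t m), dyadicDensity a i := by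
    induction m with
    | zero => simp
    | succ m ih =>
      rw [sum_range_succ, ih,
        sum_Ico_consecutive _ (hmono (Nat.zero_le m)) (hmono (Nat.le_succ m))]
  have htotal : ∑ i ∈ Ico (t 0) (t m), dyadicDensity a i ≤ 2 * Φ f := by
    calc ∑ i ∈ Ico (t 0) (t m), dyadicDensity a i
        ≤ ∑ i ∈ Ico (2 ^ 0) (2 ^ t m), dyadicDensity a i :=
          sum_le_sum_of_subset_of_nonneg
            (Ico_subset_Ico (hpos 0) (Nat.lt_two_pow_self).le)
            fun i _ _ => dyadicDensity_nonneg hanti i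
      _ = ∑ k ∈ range (t m), dyadicDrop a k := by
          rw [sum_Ico_two_pow_dyadicDensity a (Nat.zero_le _), range_eq_Ico]
      _ ≤ 2 * (a 0 - a (t m)) := sum_dyadicDrop_le hanti _
      _ ≤ 2 * Φ f := by
          have : 0 ≤ a (t m) := hΦ.nonneg _
          linarith
  rw [mul_sum]
  calc ∑ k ∈ range m, c * Φ (ergAvg T (t (k + 1)) f - ergAvg T (t k) f)
      ≤ ∑ k ∈ range m, 2 ^ p * 2 ^ p * (2 ^ p * 2 ^ p * 2 ^ p * 64) *
          ∑ i ∈ Ico (t k) (t (k + 1)), dyadicDensity a i :=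
        sum_le_sum fun k _ => hΦ.map_ergAvg_sub_le hp hc hT f (hpos k) (hmono (Nat.le_succ k))
    _ ≤ 2 ^ p * 2 ^ p * (2 ^ p * 2 ^ p * 2 ^ p * 64) * (2 * Φ f) := by
        rw [← mul_sum, hmass]
        gcongr

end IsUniformGauge

/-- Theorem (main variational inequality): for `p ≥ 2`, `K, B₁, B₂ > 0` there is a constant
`C > 0` depending only on these data such that for every real Banach space `B` with modulus of
uniform convexity `η(ε) = K ε^p`, every linear operator `T` power bounded from above and below by
`B₂`, `B₁`, every `x` and every strictly increasing sequence `(t k)` of positive integers,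
`∑ₖ ‖A_{t(k+1)} x − A_{t k} x‖^p ≤ C ‖x‖^p` (stated via all partial sums). -/
theorem stmt0 (p K B₁ B₂ : ℝ) (hp : 2 ≤ p) (hK : 0 < K) (hB₁ : 0 < B₁) (hB₂ : 0 < B₂) :
    ∃ C : ℝ, 0 < C ∧
      ∀ (B : Type*) [NormedAddCommGroup B] [NormedSpace ℝ B] [CompleteSpace B],
        (∀ ε ∈ Set.Ioc (0 : ℝ) 2, ∀ x y : B, ‖x‖ ≤ 1 → ‖y‖ ≤ 1 → ε ≤ ‖x - y‖ →
          ‖(1 / 2 : ℝ) • (x + y)‖ ≤ 1 - K * ε ^ p) →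
        ∀ T : B →ₗ[ℝ] B,
          (∀ (n : ℕ) (y : B), B₁ * ‖y‖ ≤ ‖(T ^ n) y‖ ∧ ‖(T ^ n) y‖ ≤ B₂ * ‖y‖) →
          ∀ x : B, ∀ t : ℕ → ℕ, StrictMono t → (∀ k, 0 < t k) →
            ∀ m : ℕ,
              ∑ k ∈ Finset.range m, ‖ergAvg T (t (k + 1)) x - ergAvg T (t k) x‖ ^ p
                ≤ C * ‖x‖ ^ p := by
  set c : ℝ := min ((1 / 8) ^ p) (K / 4 * (1 / 4) ^ p) with hcdef
  have hc : 0 < c := lt_min (by positivity) (by positivity)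
  set D : ℝ := 2 ^ p * 2 ^ p * (2 ^ p * 2 ^ p * 2 ^ p * 64) with hD
  have hDpos : 0 < D := by positivity
  have hB₁p : 0 < B₁ ^ p := Real.rpow_pos_of_pos hB₁ p
  have hB₂p : 0 < B₂ ^ p := Real.rpow_pos_of_pos hB₂ p
  refine ⟨D * 2 * B₂ ^ p / (c * B₁ ^ p), by positivity, ?_⟩
  intro B _ _ _ huc T hT x t ht hpos m
  obtain ⟨Φ, hΦ, hTΦ, hequiv⟩ :=
    exists_invariant_gauge (by linarith) hB₁ (uniform_midpoint hp hK huc) T hT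
  have hvar := hΦ.sum_map_ergAvg_sub_le hp hc hTΦ x ht.monotone hpos m
  have hlow : B₁ ^ p * ∑ k ∈ Finset.range m, ‖ergAvg T (t (k + 1)) x - ergAvg T (t k) x‖ ^ p ≤
      ∑ k ∈ Finset.range m, Φ (ergAvg T (t (k + 1)) x - ergAvg T (t k) x) := by
    rw [Finset.mul_sum]
    refine Finset.sum_le_sum fun k _ => ?_
    rw [← Real.mul_rpow hB₁.le (norm_nonneg _)]
    exact (hequiv _).1
  have hupp : Φ x ≤ B₂ ^ p * ‖x‖ ^ p := by
    rw [← Real.mul_rpow hB₂.le (norm_nonneg _)]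
    exact (hequiv x).2
  rw [div_mul_eq_mul_div, le_div_iff₀ (by positivity)]
  have h1 := mul_le_mul_of_nonneg_left hlow hc.le
  have h2 := mul_le_mul_of_nonneg_left hupp (by positivity : 0 ≤ D * 2)
  linarith
end

section
/- Let p ≥ 2 and K > 0. There exists a constant C > 0, depending only on p and K, with the following property: for every real Banach space B with modulus of uniform convexity η(ε) = K ε^p, every nonexpansive linear operator T on B, every x ∈ B with x ≠ 0, and every ε > 0 with ‖x‖/ε ≥ 2, the sequence of ergodic averages (A_n x)_{n≥1} admits at most C ρ^{p+1} log ρ many ε-fluctuations, where ρ = ‖x‖/ε and log is the natural logarithm. -/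
open Finset

/-- The sequence `(a n)_{n ≥ 1}` admits `k` `ε`-fluctuations: there are indices
`1 ≤ i₁ ≤ j₁ ≤ i₂ ≤ j₂ ≤ … ≤ i_k ≤ j_k` with `‖a (j u) - a (i u)‖ ≥ ε` for each `u`. -/
def AdmitsFluctuations {B : Type*} [NormedAddCommGroup B] (a : ℕ → B) (ε : ℝ) (k : ℕ) : Prop :=
  ∃ i j : ℕ → ℕ,
    (∀ u < k, 1 ≤ i u ∧ i u ≤ j u ∧ ε ≤ ‖a (j u) - a (i u)‖) ∧
    (∀ u, u + 1 < k → j u ≤ i (u + 1))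

/-- If all terms lie within `c` of `z`, so does their mean. -/
lemma norm_mean_sub_le {B : Type*} [NormedAddCommGroup B] [NormedSpace ℝ B]
    {m : ℕ} (hm : 1 ≤ m) (f : ℕ → B) (z : B) (c : ℝ) (h : ∀ r < m, ‖f r - z‖ ≤ c) :
    ‖(m : ℝ)⁻¹ • ∑ r ∈ Finset.range m, f r - z‖ ≤ c := by
  have hm0 : (0 : ℝ) < m := by exact_mod_cast hm
  have key : (m : ℝ)⁻¹ • ∑ r ∈ Finset.range m, f r - z
      = (m : ℝ)⁻¹ • ∑ r ∈ Finset.range m, (f r - z) := by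
    rw [Finset.sum_sub_distrib, smul_sub, Finset.sum_const, Finset.card_range,
      ← Nat.cast_smul_eq_nsmul ℝ, inv_smul_smul₀ hm0.ne']
  rw [key, norm_smul, norm_inv, Real.norm_natCast, inv_mul_le_iff₀ hm0]
  calc ‖∑ r ∈ Finset.range m, (f r - z)‖ ≤ ∑ r ∈ Finset.range m, c :=
        norm_sum_le_of_le _ fun r hr => h r (Finset.mem_range.1 hr)
    _ = m * c := by simp

section Averages

variable {B : Type*} [NormedAddCommGroup B] [NormedSpace ℝ B] {T : B →ₗ[ℝ] B}

lemma norm_pow_apply_le (hT : ∀ y : B, ‖T y‖ ≤ ‖y‖) (r : ℕ) (y : B) : ‖(T ^ r) y‖ ≤ ‖y‖ := by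
  induction r with
  | zero => simp
  | succ r ih =>
    rw [pow_succ', Module.End.mul_apply]
    exact (hT _).trans ih

lemma ergAvg_add (T : B →ₗ[ℝ] B) (n : ℕ) (x y : B) :
    ergAvg T n (x + y) = ergAvg T n x + ergAvg T n y := by
  simp [ergAvg, Finset.sum_add_distrib, smul_add]

lemma ergAvg_smul (T : B →ₗ[ℝ] B) (n : ℕ) (c : ℝ) (x : B) :
    ergAvg T n (c • x) = c • ergAvg T n x := by
  simp [ergAvg, ← Finset.smul_sum, smul_comm c]

lemma ergAvg_sum (T : B →ₗ[ℝ] B) (n : ℕ) (s : Finset ℕ) (f : ℕ → B) :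
    ergAvg T n (∑ r ∈ s, f r) = ∑ r ∈ s, ergAvg T n (f r) := by
  simp only [ergAvg, map_sum, ← Finset.smul_sum]
  rw [Finset.sum_comm]

lemma norm_ergAvg_le (hT : ∀ y : B, ‖T y‖ ≤ ‖y‖) {n : ℕ} (hn : 1 ≤ n) (x : B) :
    ‖ergAvg T n x‖ ≤ ‖x‖ := by
  simpa [ergAvg] using norm_mean_sub_le hn (fun r => (T ^ r) x) 0 ‖x‖
    fun r _ => by simpa using norm_pow_apply_le hT r x

/-- Averages are almost invariant under powers of `T`. -/
lemma norm_ergAvg_pow_sub_le (hT : ∀ y : B, ‖T y‖ ≤ ‖y‖) (n : ℕ) (r : ℕ) (y : B) :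
    ‖ergAvg T n ((T ^ r) y) - ergAvg T n y‖ ≤ 2 * r * ‖y‖ / n := by
  have step : ∀ w : B, ‖ergAvg T n (T w) - ergAvg T n w‖ ≤ 2 * ‖w‖ / n := by
    intro w
    have h : ergAvg T n (T w) - ergAvg T n w = (n : ℝ)⁻¹ • ((T ^ n) w - w) := by
      have h2 := Finset.sum_range_sub (fun i => (T ^ i) w) n
      simp only [pow_zero, Module.End.one_apply] at h2
      rw [← h2, Finset.sum_sub_distrib, smul_sub]
      simp [ergAvg, pow_succ]
    rw [h, norm_smul, norm_inv, Real.norm_natCast, ← div_eq_inv_mul]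
    gcongr
    linarith [norm_sub_le ((T ^ n) w) w, norm_pow_apply_le hT n w]
  induction r with
  | zero => simp
  | succ r ih =>
    have h1 := step ((T ^ r) y)
    have h2 : 2 * ‖(T ^ r) y‖ / n ≤ 2 * ‖y‖ / n := by
      gcongr
      exact norm_pow_apply_le hT r y
    have h3 := norm_sub_le_norm_sub_add_norm_sub (ergAvg T n ((T ^ (r + 1)) y))
      (ergAvg T n ((T ^ r) y)) (ergAvg T n y)
    rw [pow_succ', Module.End.mul_apply] at h3 ⊢
    have h4 : 2 * ((r + 1 : ℕ) : ℝ) * ‖y‖ / n = 2 * ‖y‖ / n + 2 * r * ‖y‖ / n := by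
      push_cast
      ring
    linarith

/-- Averaging first over a short window barely changes a long average. -/
lemma norm_ergAvg_ergAvg_sub_le (hT : ∀ y : B, ‖T y‖ ≤ ‖y‖) {m : ℕ} (hm : 1 ≤ m) (n : ℕ)
    (x : B) : ‖ergAvg T n (ergAvg T m x) - ergAvg T n x‖ ≤ 2 * m * ‖x‖ / n := by
  have h : ergAvg T n (ergAvg T m x)
      = (m : ℝ)⁻¹ • ∑ r ∈ Finset.range m, ergAvg T n ((T ^ r) x) := by
    rw [← ergAvg_sum, ← ergAvg_smul]
    rfl
  rw [h]
  refine norm_mean_sub_le hm _ _ _ fun r hr => (norm_ergAvg_pow_sub_le hT n r x).trans ?_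
  gcongr

lemma norm_ergAvg_sub_ergAvg_le (hT : ∀ y : B, ‖T y‖ ≤ ‖y‖) {i j : ℕ} (hi : 1 ≤ i) (hij : i ≤ j)
    (x : B) : ‖ergAvg T j x - ergAvg T i x‖ ≤ 2 * ‖x‖ * (1 - (i : ℝ) / j) := by
  obtain ⟨l, rfl⟩ := Nat.exists_eq_add_of_le hij
  have hi0 : (0 : ℝ) < i := by exact_mod_cast hi
  have hj0 : (0 : ℝ) < ((i + l : ℕ) : ℝ) := by positivity
  have h1 : ((i + l : ℕ) : ℝ) • ergAvg T (i + l) x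
      = (i : ℝ) • ergAvg T i x + ∑ r ∈ Finset.range l, (T ^ (i + r)) x := by
    rw [ergAvg, ergAvg, smul_inv_smul₀ hj0.ne', smul_inv_smul₀ hi0.ne', Finset.sum_range_add]
  have h2 : ((i + l : ℕ) : ℝ) • (ergAvg T (i + l) x - ergAvg T i x)
      = ∑ r ∈ Finset.range l, (T ^ (i + r)) x - (l : ℝ) • ergAvg T i x := by
    rw [smul_sub, h1, Nat.cast_add, add_smul]
    abel
  have h3 : ‖∑ r ∈ Finset.range l, (T ^ (i + r)) x‖ ≤ l * ‖x‖ :=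
    (norm_sum_le_of_le _ fun r _ => norm_pow_apply_le hT (i + r) x).trans (by simp)
  have h4 : ‖(l : ℝ) • ergAvg T i x‖ ≤ l * ‖x‖ := by
    rw [norm_smul, Real.norm_natCast]
    gcongr
    exact norm_ergAvg_le hT hi x
  have h5 := congrArg norm h2
  rw [norm_smul, Real.norm_natCast] at h5
  have h6 : ((i + l : ℕ) : ℝ) * ‖ergAvg T (i + l) x - ergAvg T i x‖ ≤ 2 * l * ‖x‖ := by
    rw [h5]
    linarith [norm_sub_le (∑ r ∈ Finset.range l, (T ^ (i + r)) x) ((l : ℝ) • ergAvg T i x)]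
  have h7 : 2 * ‖x‖ * (1 - (i : ℝ) / ((i + l : ℕ) : ℝ)) = 2 * l * ‖x‖ / ((i + l : ℕ) : ℝ) := by
    field_simp
    push_cast
    ring
  rw [h7, le_div_iff₀ hj0]
  linarith

/-- A fluctuation needs a proportional increase of the index, measured logarithmically. -/
lemma le_log_sub_log_of_fluctuation (hT : ∀ y : B, ‖T y‖ ≤ ‖y‖) {i j : ℕ} (hi : 1 ≤ i)
    (hij : i ≤ j) {x : B} {ε : ℝ} (h : ε ≤ ‖ergAvg T j x - ergAvg T i x‖) :
    ε ≤ 2 * ‖x‖ * (Real.log j - Real.log i) := by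
  have hi0 : (0 : ℝ) < i := by exact_mod_cast hi
  have hj0 : (0 : ℝ) < j := by exact_mod_cast hi.trans hij
  refine (h.trans (norm_ergAvg_sub_ergAvg_le hT hi hij x)).trans ?_
  refine mul_le_mul_of_nonneg_left ?_ (by positivity)
  have := Real.one_sub_inv_le_log_of_pos (div_pos hj0 hi0)
  rwa [inv_div, Real.log_div hj0.ne' hi0.ne'] at this

/-- The scaled modulus of convexity, with the drop measured against a larger scale `X`. -/
lemma norm_midpoint_le {p K : ℝ} (hp : 2 ≤ p) (hK : 0 < K)
    (hB : ∀ ε ∈ Set.Ioc (0 : ℝ) 2, ∀ x y : B, ‖x‖ ≤ 1 → ‖y‖ ≤ 1 → ε ≤ ‖x - y‖ →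
      ‖(1 / 2 : ℝ) • (x + y)‖ ≤ 1 - K * ε ^ p)
    {y z : B} {X e : ℝ} (hy : ‖y‖ ≤ X) (hz : ‖z‖ ≤ ‖y‖) (he : 0 < e) (h : e ≤ ‖y - z‖) :
    ‖(1 / 2 : ℝ) • (y + z)‖ ≤ ‖y‖ - X * (K * (e / X) ^ p) := by
  have h2 : e ≤ 2 * ‖y‖ := by linarith [norm_sub_le y z]
  have hy0 : 0 < ‖y‖ := by linarith
  have hX : 0 < X := hy0.trans_le hy
  have hn : ∀ w : B, ‖(‖y‖⁻¹ : ℝ) • w‖ = ‖y‖⁻¹ * ‖w‖ := fun w => by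
    rw [norm_smul, norm_inv, norm_norm]
  have key := hB (e / ‖y‖) ⟨by positivity, by rwa [div_le_iff₀ hy0]⟩ ((‖y‖⁻¹ : ℝ) • y)
    ((‖y‖⁻¹ : ℝ) • z) (by rw [hn, inv_mul_cancel₀ hy0.ne'])
    (by rw [hn, inv_mul_le_iff₀ hy0]; linarith)
    (by rw [← smul_sub, hn, div_eq_inv_mul]; gcongr)
  rw [← smul_add, smul_comm, hn, inv_mul_le_iff₀ hy0] at key
  refine key.trans ?_
  have h3 : X * (e / X) ^ p ≤ ‖y‖ * (e / ‖y‖) ^ p := by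
    have h4 : e / ‖y‖ = e / X * (X / ‖y‖) := by field_simp
    have h5 : 1 ≤ X / ‖y‖ := by rwa [one_le_div hy0]
    have h6 : X / ‖y‖ ≤ (X / ‖y‖) ^ p := by
      simpa using Real.rpow_le_rpow_of_exponent_le h5 (show (1 : ℝ) ≤ p by linarith)
    rw [h4, Real.mul_rpow (by positivity) (by positivity)]
    calc X * (e / X) ^ p = ‖y‖ * ((e / X) ^ p * (X / ‖y‖)) := by field_simp
      _ ≤ _ := by gcongr
  nlinarith [mul_le_mul_of_nonneg_left h3 hK.le]

/-- If the averages at `i, j ≫ m` differ by `ε`, all much later averages are substantially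
shorter than the average at `m`. -/
lemma norm_ergAvg_le_of_fluctuation {p K : ℝ} (hp : 2 ≤ p) (hK : 0 < K)
    (hB : ∀ ε ∈ Set.Ioc (0 : ℝ) 2, ∀ x y : B, ‖x‖ ≤ 1 → ‖y‖ ≤ 1 → ε ≤ ‖x - y‖ →
      ‖(1 / 2 : ℝ) • (x + y)‖ ≤ 1 - K * ε ^ p)
    (hT : ∀ y : B, ‖T y‖ ≤ ‖y‖) {x : B} {ε : ℝ} (hε : 0 < ε) {m i j N : ℕ}
    (hm : 1 ≤ m) (hmi : m ≤ i) (hij : i ≤ j) (hN : 1 ≤ N)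
    (hmi' : 8 * ‖x‖ * m ≤ ε * i) (hfl : ε ≤ ‖ergAvg T j x - ergAvg T i x‖) :
    ‖ergAvg T N x‖ ≤ ‖ergAvg T m x‖ - ‖x‖ * (K * (ε / 4 / ‖x‖) ^ p) + 3 * j * ‖x‖ / N := by
  set y := ergAvg T m x with hy
  obtain ⟨n, hin, hnj, hn⟩ : ∃ n, i ≤ n ∧ n ≤ j ∧ ε / 2 ≤ ‖ergAvg T n x - y‖ := by
    by_contra! hcon
    have h1 := hcon i le_rfl hij
    have h2 := hcon j hij le_rfl
    have h3 := norm_sub_le_norm_sub_add_norm_sub (ergAvg T j x) y (ergAvg T i x)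
    rw [norm_sub_rev y] at h3
    linarith
  have hn1 : 1 ≤ n := by omega
  have hn0 : (0 : ℝ) < n := by exact_mod_cast hn1
  have hN0 : (0 : ℝ) < N := by exact_mod_cast hN
  have hclose : ‖ergAvg T n y - ergAvg T n x‖ ≤ ε / 4 := by
    refine (norm_ergAvg_ergAvg_sub_le hT hm n x).trans ?_
    rw [div_le_iff₀ hn0]
    have : ε * i ≤ ε * n := by gcongr
    linarith
  obtain ⟨r, hr, hry⟩ : ∃ r < n, ε / 4 ≤ ‖(T ^ r) y - y‖ := by
    by_contra! hcon
    obtain ⟨r₀, hr₀, hmax⟩ := Finset.exists_max_image (Finset.range n)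
      (fun r => ‖(T ^ r) y - y‖) ⟨0, Finset.mem_range.2 hn1⟩
    have h1 : ‖ergAvg T n y - y‖ ≤ ‖(T ^ r₀) y - y‖ :=
      norm_mean_sub_le hn1 _ y _ fun r hr => hmax r (Finset.mem_range.2 hr)
    have h2 := hcon r₀ (Finset.mem_range.1 hr₀)
    have h3 := norm_sub_le_norm_sub_add_norm_sub (ergAvg T n x) (ergAvg T n y) y
    rw [norm_sub_rev (ergAvg T n x) (ergAvg T n y)] at h3
    linarith
  have hyx : ‖y‖ ≤ ‖x‖ := norm_ergAvg_le hT hm x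
  have hmid := norm_midpoint_le hp hK hB hyx (norm_pow_apply_le hT r y)
    (show 0 < ε / 4 by positivity) (by rwa [norm_sub_rev])
  set z := (1 / 2 : ℝ) • (y + (T ^ r) y) with hz
  have hNz := (norm_ergAvg_le hT hN z).trans hmid
  have hzx : ergAvg T N x = ergAvg T N z - (ergAvg T N y - ergAvg T N x)
      - (1 / 2 : ℝ) • (ergAvg T N ((T ^ r) y) - ergAvg T N y) := by
    rw [hz, ergAvg_smul, ergAvg_add]
    module
  have h1 := norm_ergAvg_ergAvg_sub_le hT hm N x
  have h2 := norm_ergAvg_pow_sub_le hT N r y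
  have h3 : ‖(1 / 2 : ℝ) • (ergAvg T N ((T ^ r) y) - ergAvg T N y)‖ ≤ r * ‖x‖ / N := by
    rw [norm_smul, Real.norm_of_nonneg (by norm_num)]
    calc 1 / 2 * ‖ergAvg T N ((T ^ r) y) - ergAvg T N y‖ ≤ 1 / 2 * (2 * r * ‖y‖ / N) := by gcongr
      _ = r * ‖y‖ / N := by ring
      _ ≤ _ := by gcongr
  have h4 : 2 * m * ‖x‖ / N + r * ‖x‖ / N ≤ 3 * j * ‖x‖ / N := by
    rw [← add_div, ← add_mul]
    gcongr
    have : (m : ℝ) ≤ j := by exact_mod_cast hmi.trans hij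
    have : (r : ℝ) ≤ j := by exact_mod_cast hr.le.trans hnj
    linarith
  have h5 := norm_sub_le (ergAvg T N z - (ergAvg T N y - ergAvg T N x))
    ((1 / 2 : ℝ) • (ergAvg T N ((T ^ r) y) - ergAvg T N y))
  have h6 := norm_sub_le (ergAvg T N z) (ergAvg T N y - ergAvg T N x)
  rw [← hzx] at h5
  linarith

/-- Fluctuation count in terms of the norm at the start, for windows of `q₁` and `q₂`
fluctuations long enough to increase the index by the factors `8ρ` and `R`. -/
lemma fluctuations_le_mul {p K : ℝ} (hp : 2 ≤ p) (hK : 0 < K)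
    (hB : ∀ ε ∈ Set.Ioc (0 : ℝ) 2, ∀ x y : B, ‖x‖ ≤ 1 → ‖y‖ ≤ 1 → ε ≤ ‖x - y‖ →
      ‖(1 / 2 : ℝ) • (x + y)‖ ≤ 1 - K * ε ^ p)
    (hT : ∀ y : B, ‖T y‖ ≤ ‖y‖) {x : B} (hx : 0 < ‖x‖) {ε : ℝ} (hε : 0 < ε) {k : ℕ}
    {i j : ℕ → ℕ} (hfl : ∀ u < k, 1 ≤ i u ∧ i u ≤ j u ∧ ε ≤ ‖ergAvg T (j u) x - ergAvg T (i u) x‖)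
    (hji : ∀ u, u + 1 < k → j u ≤ i (u + 1)) {R d : ℝ} (hR : 0 < R)
    (hRd : 3 * ‖x‖ ≤ R * d) (hd : 2 * d ≤ ‖x‖ * (K * (ε / 4 / ‖x‖) ^ p)) {q₁ q₂ : ℕ}
    (hq₁ : 2 * ‖x‖ * Real.log (8 * (‖x‖ / ε)) ≤ ε * q₁) (hq₂ : 2 * ‖x‖ * Real.log R ≤ ε * q₂)
    (s u : ℕ) (hu : u < k) (hs : ‖ergAvg T (i u) x‖ < s * d) : k ≤ u + s * (q₁ + 1 + q₂) := by
  have hlog : ∀ u t, u + t < k →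
      i u ≤ i (u + t) ∧ ε * t ≤ 2 * ‖x‖ * (Real.log (i (u + t)) - Real.log (i u)) := by
    intro u t
    induction t with
    | zero => simp
    | succ t ih =>
      intro ht
      obtain ⟨ih1, ih2⟩ := ih (by omega)
      obtain ⟨h1, h2, h3⟩ := hfl (u + t) (by omega)
      have h4 := hji (u + t) (by omega)
      have h5 := le_log_sub_log_of_fluctuation hT h1 h2 h3
      have h6 : Real.log (j (u + t)) ≤ Real.log (i (u + t + 1)) :=
        Real.log_le_log (by exact_mod_cast h1.trans h2) (by exact_mod_cast h4)
      refine ⟨by rw [← add_assoc]; omega, ?_⟩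
      rw [← add_assoc]
      push_cast
      nlinarith [mul_le_mul_of_nonneg_left h6 hx.le]
  induction s generalizing u with
  | zero =>
    simp only [Nat.cast_zero, zero_mul] at hs
    exact absurd hs (not_lt.2 (norm_nonneg _))
  | succ s ih =>
    rw [Nat.succ_mul]
    by_cases hv : u + q₁ < k
    swap
    · omega
    by_cases hw : u + q₁ + 1 + q₂ < k
    swap
    · omega
    obtain ⟨hm1, -, -⟩ := hfl u hu
    obtain ⟨hi1, hij, hflv⟩ := hfl _ hv
    have hm0 : (0 : ℝ) < i u := by exact_mod_cast hm1
    have hi0 : (0 : ℝ) < i (u + q₁) := by exact_mod_cast hi1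
    have hj0 : (0 : ℝ) < j (u + q₁) := by exact_mod_cast hi1.trans hij
    obtain ⟨hmi, hmi'⟩ := hlog u q₁ hv
    obtain ⟨hvw, hvw'⟩ := hlog (u + q₁ + 1) q₂ hw
    have hjw := hji (u + q₁) (by omega)
    have hw1 : 1 ≤ i (u + q₁ + 1 + q₂) := by omega
    have hw0 : (0 : ℝ) < i (u + q₁ + 1 + q₂) := by exact_mod_cast hw1
    have h8 : 8 * ‖x‖ * i u ≤ ε * i (u + q₁) := by
      have h1 : Real.log (8 * (‖x‖ / ε)) + Real.log (i u) ≤ Real.log (i (u + q₁)) := by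
        have := le_of_mul_le_mul_left (hq₁.trans hmi') (by positivity)
        linarith
      rw [← Real.log_mul (by positivity) hm0.ne'] at h1
      have h2 := (Real.log_le_log_iff (by positivity) hi0).1 h1
      calc 8 * ‖x‖ * i u = ε * (8 * (‖x‖ / ε) * i u) := by field_simp
        _ ≤ _ := by gcongr
    have hRj : R * j (u + q₁) ≤ i (u + q₁ + 1 + q₂) := by
      have h1 : Real.log R + Real.log (j (u + q₁)) ≤ Real.log (i (u + q₁ + 1 + q₂)) := by
        have := le_of_mul_le_mul_left (hq₂.trans hvw') (by positivity)
        have : Real.log (j (u + q₁)) ≤ Real.log (i (u + q₁ + 1)) :=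
          Real.log_le_log hj0 (by exact_mod_cast hjw)
        linarith
      rw [← Real.log_mul hR.ne' hj0.ne'] at h1
      exact (Real.log_le_log_iff (by positivity) hw0).1 h1
    have hdrop := norm_ergAvg_le_of_fluctuation hp hK hB hT hε hm1 hmi hij hw1 h8 hflv
    have hd0 : 0 < d := by
      by_contra! hcon
      nlinarith [mul_nonneg hR.le (neg_nonneg.2 hcon)]
    have herr : 3 * j (u + q₁) * ‖x‖ / i (u + q₁ + 1 + q₂) ≤ d := by
      rw [div_le_iff₀ hw0]
      nlinarith [mul_le_mul_of_nonneg_left hRd hj0.le, mul_le_mul_of_nonneg_left hRj hd0.le]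
    have := ih (u + q₁ + 1 + q₂) hw (by push_cast at hs; linarith)
    omega

end Averages

/-- For a nonexpansive linear operator on a Banach space with modulus of uniform convexity
`η(ε) = K ε^p`, the sequence of ergodic averages admits at most `C ρ^{p+1} log ρ` many
`ε`-fluctuations, where `ρ = ‖x‖/ε ≥ 2`, with `C` depending only on `p` and `K`. -/
theorem stmt1 (p K : ℝ) (hp : 2 ≤ p) (hK : 0 < K) :
    ∃ C : ℝ, 0 < C ∧
      ∀ (B : Type*) [NormedAddCommGroup B] [NormedSpace ℝ B] [CompleteSpace B],
        (∀ ε ∈ Set.Ioc (0 : ℝ) 2, ∀ x y : B, ‖x‖ ≤ 1 → ‖y‖ ≤ 1 → ε ≤ ‖x - y‖ →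
          ‖(1 / 2 : ℝ) • (x + y)‖ ≤ 1 - K * ε ^ p) →
        ∀ T : B →ₗ[ℝ] B, (∀ y : B, ‖T y‖ ≤ ‖y‖) →
          ∀ x : B, x ≠ 0 → ∀ ε : ℝ, 0 < ε → 2 ≤ ‖x‖ / ε →
            ∀ k : ℕ, AdmitsFluctuations (fun n => ergAvg T n x) ε k →
              (k : ℝ) ≤ C * (‖x‖ / ε) ^ (p + 1) * Real.log (‖x‖ / ε) := by
  have hM : 0 ≤ Real.log (1 + 6 / K) :=
    Real.log_nonneg (by linarith [div_pos (by norm_num : (0 : ℝ) < 6) hK])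
  refine ⟨(2 / K + 1) * 4 ^ p * (11 + 4 * Real.log (1 + 6 / K) + 6 * p), by positivity, ?_⟩
  intro B _ _ _ hB T hT x hx ε hε hρ k hk
  obtain ⟨i, j, hfl, hji⟩ := hk
  have hx0 : 0 < ‖x‖ := norm_pos_iff.2 hx
  set ρ := ‖x‖ / ε with hρdef
  have hρ0 : 0 < ρ := by linarith
  have hxρ : ‖x‖ = ε * ρ := by rw [hρdef]; field_simp
  have hlog2 : Real.log 2 ≤ Real.log ρ := Real.log_le_log (by norm_num) hρ
  have hlogρ : 1 / 2 ≤ Real.log ρ := by linarith [Real.log_two_gt_d9]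
  rcases Nat.eq_zero_or_pos k with rfl | hk0
  · simp only [Nat.cast_zero]
    positivity
  have h4ρ : 1 ≤ (4 * ρ) ^ p := Real.one_le_rpow (by linarith) (by linarith)
  set P := (4 * ρ) ^ p with hP
  have hP0 : 0 < P := by linarith
  set R := (1 + 6 / K) * P with hRdef
  have hR : 0 < R := by positivity
  set d := ‖x‖ * K / (2 * P) with hddef
  have hd0 : 0 < d := by positivity
  have hlog8 : Real.log (8 * ρ) ≤ 4 * Real.log ρ := by
    rw [Real.log_mul (by norm_num) hρ0.ne', show (8 : ℝ) = 2 ^ 3 by norm_num, Real.log_pow]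
    push_cast
    linarith
  have hlogR : Real.log R ≤ 2 * Real.log (1 + 6 / K) * Real.log ρ + p * (3 * Real.log ρ) := by
    rw [hRdef, Real.log_mul (by positivity) hP0.ne', hP, Real.log_rpow (by positivity),
      Real.log_mul (by norm_num) hρ0.ne', show (4 : ℝ) = 2 ^ 2 by norm_num, Real.log_pow]
    push_cast
    have h1 : p * (2 * Real.log 2 + Real.log ρ) ≤ p * (3 * Real.log ρ) := by
      gcongr
      linarith
    nlinarith [mul_le_mul_of_nonneg_left hlogρ hM]
  have hR1 : 1 ≤ R := by
    rw [hRdef]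
    nlinarith [div_pos (by norm_num : (0 : ℝ) < 6) hK]
  have hcount := fluctuations_le_mul hp hK hB hT hx0 hε hfl hji (R := R) (d := d)
    (q₁ := ⌈2 * ρ * Real.log (8 * ρ)⌉₊) (q₂ := ⌈2 * ρ * Real.log R⌉₊) hR
    (by
      have : R * d = ‖x‖ * K / 2 + 3 * ‖x‖ := by
        rw [hRdef, hddef]
        field_simp
        ring
      rw [this]
      linarith [mul_pos hx0 hK])
    (by
      have h1 : ε / 4 / ‖x‖ = (4 * ρ)⁻¹ := by
        rw [hxρ]
        field_simp
      rw [h1, Real.inv_rpow (by positivity), ← hP, hddef]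
      apply le_of_eq
      field_simp)
    (by
      rw [← hρdef, hxρ]
      nlinarith [mul_le_mul_of_nonneg_left (Nat.le_ceil (2 * ρ * Real.log (8 * ρ))) hε.le])
    (by
      rw [hxρ]
      nlinarith [mul_le_mul_of_nonneg_left (Nat.le_ceil (2 * ρ * Real.log R)) hε.le])
    (⌊‖x‖ / d⌋₊ + 1) 0 hk0
    (by
      refine (norm_ergAvg_le hT (hfl 0 hk0).1 x).trans_lt ?_
      rw [← div_lt_iff₀ hd0]
      push_cast
      exact Nat.lt_floor_add_one _)
  have hs : ((⌊‖x‖ / d⌋₊ + 1 : ℕ) : ℝ) ≤ (2 / K + 1) * P := by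
    have h1 := Nat.floor_le (show 0 ≤ ‖x‖ / d by positivity)
    have h2 : ‖x‖ / d = 2 / K * P := by
      rw [hddef]
      field_simp
    push_cast
    linarith
  have hQ : ((⌈2 * ρ * Real.log (8 * ρ)⌉₊ + 1 + ⌈2 * ρ * Real.log R⌉₊ : ℕ) : ℝ)
      ≤ (11 + 4 * Real.log (1 + 6 / K) + 6 * p) * (ρ * Real.log ρ) := by
    have h1 := Nat.ceil_lt_add_one (show 0 ≤ 2 * ρ * Real.log (8 * ρ) from
      mul_nonneg (by positivity) (Real.log_nonneg (by linarith)))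
    have h2 := Nat.ceil_lt_add_one (show 0 ≤ 2 * ρ * Real.log R from
      mul_nonneg (by positivity) (Real.log_nonneg hR1))
    have h3 := mul_le_mul_of_nonneg_left hlog8 (show 0 ≤ 2 * ρ by positivity)
    have h4 := mul_le_mul_of_nonneg_left hlogR (show 0 ≤ 2 * ρ by positivity)
    have h5 : 1 ≤ ρ * Real.log ρ := by nlinarith
    push_cast
    linarith
  have hPρ : P = 4 ^ p * ρ ^ p := Real.mul_rpow (by norm_num) hρ0.le
  calc (k : ℝ) ≤ ((⌊‖x‖ / d⌋₊ + 1 : ℕ) : ℝ) *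
        ((⌈2 * ρ * Real.log (8 * ρ)⌉₊ + 1 + ⌈2 * ρ * Real.log R⌉₊ : ℕ) : ℝ) := by
        rw [zero_add] at hcount
        exact_mod_cast hcount
    _ ≤ ((2 / K + 1) * P) *
        ((11 + 4 * Real.log (1 + 6 / K) + 6 * p) * (ρ * Real.log ρ)) := by gcongr
    _ = _ := by
      rw [hPρ, Real.rpow_add_one hρ0.ne']
      ring
end

section
/- Let H be a real (or complex) Hilbert space and let T be a nonexpansive linear operator on H. Then for every x ∈ H and every strictly increasing sequence (t_k)_{k∈ℕ} of positive integers, ∑_k ‖A_{t_{k+1}} x − A_{t_k} x‖² ≤ 625 ‖x‖². -/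
open Finset

/-- **Parseval's identity** for the discrete Fourier transform on `ZMod N`. -/
theorem ZMod.sum_norm_sq_dft {N : ℕ} [NeZero N] (Φ : ZMod N → ℂ) :
    ∑ k, ‖ZMod.dft Φ k‖ ^ 2 = N * ∑ j, ‖Φ j‖ ^ 2 := by
  have hconj (j k : ZMod N) : (starRingEnd ℂ) (ZMod.stdAddChar (-(j * k))) =
      ZMod.stdAddChar (-(k * -j)) := by
    rw [mul_neg, neg_neg, mul_comm k j, ← AddChar.map_neg_eq_conj, neg_neg]
  have key : ∑ k, ZMod.dft Φ k * (starRingEnd ℂ) (ZMod.dft Φ k) =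
      N * ∑ j, Φ j * (starRingEnd ℂ) (Φ j) := by
    calc ∑ k, ZMod.dft Φ k * (starRingEnd ℂ) (ZMod.dft Φ k)
        = ∑ k, ∑ j, (ZMod.stdAddChar (-(k * -j)) * ZMod.dft Φ k) * (starRingEnd ℂ) (Φ j) := by
          refine Finset.sum_congr rfl fun k _ ↦ ?_
          rw [ZMod.dft_apply Φ k, map_sum, Finset.mul_sum]
          refine Finset.sum_congr rfl fun j _ ↦ ?_
          rw [smul_eq_mul, map_mul, hconj]
          ring
      _ = ∑ j, ZMod.dft (ZMod.dft Φ) (-j) * (starRingEnd ℂ) (Φ j) := by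
          rw [Finset.sum_comm]
          refine Finset.sum_congr rfl fun j _ ↦ ?_
          rw [ZMod.dft_apply (ZMod.dft Φ), Finset.sum_mul]
          simp only [smul_eq_mul]
      _ = N * ∑ j, Φ j * (starRingEnd ℂ) (Φ j) := by
          rw [Finset.mul_sum]
          refine Finset.sum_congr rfl fun j _ ↦ ?_
          simp only [ZMod.dft_dft, neg_neg, smul_eq_mul, mul_assoc]
  simp only [Complex.mul_conj'] at key
  exact_mod_cast key

/-- The discrete Fourier transform turns a cyclic correlation into a multiplication. -/
theorem ZMod.dft_sum_mul_shift {N : ℕ} [NeZero N] (M : ℕ) (c : ℕ → ℂ) (a : ZMod N → ℂ)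
    (k : ZMod N) :
    ZMod.dft (fun j : ZMod N ↦ ∑ i ∈ range M, c i * a (j + (i : ZMod N))) k =
      (∑ i ∈ range M, c i * ZMod.stdAddChar k ^ i) * ZMod.dft a k := by
  rw [ZMod.dft_apply]
  simp only [smul_eq_mul, Finset.mul_sum, Finset.sum_mul]
  rw [Finset.sum_comm]
  refine Finset.sum_congr rfl fun i _ ↦ ?_
  rw [ZMod.dft_apply, Finset.mul_sum]
  refine Fintype.sum_equiv (Equiv.addRight (i : ZMod N)) _ _ fun j ↦ ?_
  have h : ZMod.stdAddChar (-(j * k)) =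
      ZMod.stdAddChar k ^ i * ZMod.stdAddChar (-((j + (i : ZMod N)) * k)) := by
    rw [← AddChar.map_nsmul_eq_pow, ← AddChar.map_add_eq_mul, nsmul_eq_mul]
    congr 1
    ring
  rw [h, Equiv.coe_addRight, smul_eq_mul]
  ring

/-- A square function of polynomials that is bounded on the unit circle is bounded, as a family of
cyclic correlations, on `ℓ²(ZMod N)`. -/
theorem sum_cyclic_correlation_sq_le {ι : Type*} (s : Finset ι) (M : ℕ) (c : ι → ℕ → ℝ) (C : ℝ)
    (hc : ∀ z : ℂ, ‖z‖ = 1 → ∑ k ∈ s, ‖∑ i ∈ range M, (c k i : ℂ) * z ^ i‖ ^ 2 ≤ C)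
    {N : ℕ} [NeZero N] (a : ZMod N → ℝ) :
    ∑ k ∈ s, ∑ j, (∑ i ∈ range M, c k i * a (j + i)) ^ 2 ≤ C * ∑ j, a j ^ 2 := by
  have hN : (0 : ℝ) < N := Nat.cast_pos.mpr (NeZero.pos N)
  have hsq (r : ℝ) : r ^ 2 = ‖(r : ℂ)‖ ^ 2 := by simp
  refine le_of_mul_le_mul_left ?_ hN
  calc (N : ℝ) * ∑ k ∈ s, ∑ j, (∑ i ∈ range M, c k i * a (j + i)) ^ 2
      = ∑ k ∈ s, ∑ l, ‖∑ i ∈ range M, (c k i : ℂ) * ZMod.stdAddChar l ^ i‖ ^ 2 *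
          ‖ZMod.dft (fun j ↦ (a j : ℂ)) l‖ ^ 2 := by
        rw [Finset.mul_sum]
        refine Finset.sum_congr rfl fun k _ ↦ ?_
        simp only [← mul_pow, ← norm_mul, ← ZMod.dft_sum_mul_shift, ZMod.sum_norm_sq_dft]
        congr 1
        refine Finset.sum_congr rfl fun j _ ↦ ?_
        rw [hsq]
        push_cast
        rfl
    _ = ∑ l, (∑ k ∈ s, ‖∑ i ∈ range M, (c k i : ℂ) * ZMod.stdAddChar l ^ i‖ ^ 2) *
          ‖ZMod.dft (fun j ↦ (a j : ℂ)) l‖ ^ 2 := by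
        rw [Finset.sum_comm]
        simp only [Finset.sum_mul]
    _ ≤ ∑ l, C * ‖ZMod.dft (fun j ↦ (a j : ℂ)) l‖ ^ 2 := by
        gcongr with l
        exact hc _ (by rw [ZMod.stdAddChar_apply]; exact Circle.norm_coe _)
    _ = N * (C * ∑ j, a j ^ 2) := by
        rw [← Finset.mul_sum, ZMod.sum_norm_sq_dft]
        simp only [← hsq]
        ring

theorem norm_sq_sub_norm_sq_map_sum {H : Type*} [NormedAddCommGroup H] [InnerProductSpace ℝ H]
    (S : H →ₗ[ℝ] H) {β : Type*} (F : Finset β) (w : β → ℝ) (v : β → H) :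
    ‖∑ i ∈ F, w i • v i‖ ^ 2 - ‖S (∑ i ∈ F, w i • v i)‖ ^ 2 =
      ∑ i ∈ F, ∑ j ∈ F,
        w i * w j * (inner ℝ (v i) (v j) - inner ℝ (S (v i)) (S (v j))) := by
  simp only [← real_inner_self_eq_norm_sq, map_sum, map_smul, sum_inner, inner_sum,
    real_inner_smul_left, real_inner_smul_right, ← Finset.sum_sub_distrib]
  refine Finset.sum_congr rfl fun i _ ↦ Finset.sum_congr rfl fun j _ ↦ ?_
  rw [real_inner_comm (v i), real_inner_comm (S (v i))]
  ring

/-- Coordinates for the semi-inner product `⟪v, w⟫ - ⟪S v, S w⟫` of a contraction `S` on finitely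
many vectors. -/
theorem exists_coordinates_inner_sub_inner_map {H : Type*} [NormedAddCommGroup H]
    [InnerProductSpace ℝ H] (S : H →ₗ[ℝ] H) (hS : ∀ y, ‖S y‖ ≤ ‖y‖) {α : Type*} [Fintype α]
    (u : α → H) :
    ∃ (d : ℕ) (R : Fin d → α → ℝ), ∀ i j,
      inner ℝ (u i) (u j) - inner ℝ (S (u i)) (S (u j)) = ∑ l, R l i * R l j := by
  let G : Matrix α α ℝ := .of fun i j ↦ inner ℝ (u i) (u j) - inner ℝ (S (u i)) (S (u j))
  have hpos : G.PosSemidef := by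
    refine Matrix.PosSemidef.of_dotProduct_mulVec_nonneg ?_ fun w ↦ ?_
    · ext i j
      simp [G, real_inner_comm]
    · have h : star w ⬝ᵥ G.mulVec w =
          ‖∑ i, w i • u i‖ ^ 2 - ‖S (∑ i, w i • u i)‖ ^ 2 := by
        rw [norm_sq_sub_norm_sq_map_sum]
        simp only [dotProduct, Matrix.mulVec, Finset.mul_sum, star_trivial, G, Matrix.of_apply]
        refine Finset.sum_congr rfl fun i _ ↦ Finset.sum_congr rfl fun j _ ↦ ?_
        ring
      rw [h, sub_nonneg]
      gcongr
      exact hS _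
  obtain ⟨d, R, hR⟩ := Matrix.posSemidef_iff_eq_sum_vecMulVec.mp hpos
  refine ⟨d, R, fun i j ↦ ?_⟩
  have h := congrFun (congrFun hR i) j
  simpa [G, Matrix.sum_apply, Matrix.vecMulVec_apply] using h

theorem sum_norm_sq_sub_norm_sq_pow_le {H : Type*} [NormedAddCommGroup H]
    [InnerProductSpace ℝ H] {ι : Type*} (s : Finset ι) (M : ℕ) (c : ι → ℕ → ℝ) (C : ℝ)
    (hc : ∀ z : ℂ, ‖z‖ = 1 → ∑ k ∈ s, ‖∑ i ∈ range M, (c k i : ℂ) * z ^ i‖ ^ 2 ≤ C)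
    (S : H →ₗ[ℝ] H) (hS : ∀ y, ‖S y‖ ≤ ‖y‖) (x : H) (L : ℕ) :
    ∑ k ∈ s, (‖∑ i ∈ range M, c k i • (S ^ i) x‖ ^ 2 -
      ‖(S ^ L) (∑ i ∈ range M, c k i • (S ^ i) x)‖ ^ 2) ≤ C * ‖x‖ ^ 2 := by
  have hC : 0 ≤ C := (Finset.sum_nonneg fun _ _ ↦ by positivity).trans (hc 1 (by simp))
  have telescope (n : ℕ) (y : H) : ‖y‖ ^ 2 - ‖(S ^ n) y‖ ^ 2 =
      ∑ j ∈ range n, (‖(S ^ j) y‖ ^ 2 - ‖S ((S ^ j) y)‖ ^ 2) := by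
    simp only [← Module.End.mul_apply, ← pow_succ']
    rw [Finset.sum_range_sub' fun j ↦ ‖(S ^ j) y‖ ^ 2]
    simp
  let N := L + M + 1
  obtain ⟨d, R, hR⟩ :=
    exists_coordinates_inner_sub_inner_map S hS fun a : ZMod N ↦ (S ^ a.val) x
  have hval {j : ℕ} (hj : j < N) : ((j : ZMod N)).val = j := ZMod.val_cast_of_lt hj
  have sum_cast (f : ZMod N → ℝ) : ∑ a, f a = ∑ j ∈ range N, f j := by
    rw [← Fin.sum_univ_eq_sum_range (fun j ↦ f j)]
    exact Finset.sum_congr rfl fun j _ ↦ congrArg f (ZMod.natCast_zmod_val j).symm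
  have hnorm {j : ℕ} (hj : j < L) (k : ι) :
      ‖(S ^ j) (∑ i ∈ range M, c k i • (S ^ i) x)‖ ^ 2 -
        ‖S ((S ^ j) (∑ i ∈ range M, c k i • (S ^ i) x))‖ ^ 2 =
      ∑ l, (∑ i ∈ range M, c k i * R l ((j : ZMod N) + i)) ^ 2 := by
    have hmap : (S ^ j) (∑ i ∈ range M, c k i • (S ^ i) x) =
        ∑ i ∈ range M, c k i • (S ^ ((j : ZMod N) + i).val) x := by
      rw [map_sum]
      refine Finset.sum_congr rfl fun i hi ↦ ?_
      rw [Finset.mem_range] at hi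
      rw [map_smul, ← Module.End.mul_apply, ← pow_add, ← Nat.cast_add, hval (by omega)]
    rw [hmap, norm_sq_sub_norm_sq_map_sum]
    simp only [hR, Finset.mul_sum]
    rw [Finset.sum_comm_cycle]
    refine Finset.sum_congr rfl fun l _ ↦ ?_
    rw [sq, Finset.sum_mul_sum, Finset.sum_comm]
    refine Finset.sum_congr rfl fun i _ ↦ Finset.sum_congr rfl fun j _ ↦ ?_
    ring
  have hRx : ∑ l, ∑ a, R l a ^ 2 ≤ ‖x‖ ^ 2 := by
    calc ∑ l, ∑ a, R l a ^ 2 = ∑ j ∈ range N, ∑ l, R l j ^ 2 := by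
          simp only [sum_cast]
          rw [Finset.sum_comm]
      _ = ‖x‖ ^ 2 - ‖(S ^ N) x‖ ^ 2 := by
          rw [telescope]
          refine Finset.sum_congr rfl fun j hj ↦ ?_
          have := hR j j
          rw [hval (Finset.mem_range.mp hj), real_inner_self_eq_norm_sq,
            real_inner_self_eq_norm_sq] at this
          rw [this]
          exact Finset.sum_congr rfl fun l _ ↦ sq _
      _ ≤ ‖x‖ ^ 2 := sub_le_self _ (by positivity)
  calc ∑ k ∈ s, (‖∑ i ∈ range M, c k i • (S ^ i) x‖ ^ 2 -
        ‖(S ^ L) (∑ i ∈ range M, c k i • (S ^ i) x)‖ ^ 2)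
      = ∑ k ∈ s, ∑ j ∈ range L, ∑ l,
          (∑ i ∈ range M, c k i * R l ((j : ZMod N) + i)) ^ 2 := by
        refine Finset.sum_congr rfl fun k _ ↦ ?_
        rw [telescope]
        exact Finset.sum_congr rfl fun j hj ↦ hnorm (Finset.mem_range.mp hj) k
    _ ≤ ∑ k ∈ s, ∑ j ∈ range N, ∑ l,
          (∑ i ∈ range M, c k i * R l ((j : ZMod N) + i)) ^ 2 := by
        gcongr
        omega
    _ = ∑ l, ∑ k ∈ s, ∑ a, (∑ i ∈ range M, c k i * R l (a + i)) ^ 2 := by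
        simp only [sum_cast]
        rw [Finset.sum_comm_cycle]
    _ ≤ ∑ l, C * ∑ a, R l a ^ 2 := by
        gcongr with l
        exact sum_cyclic_correlation_sq_le s M c C hc (R l)
    _ ≤ C * ‖x‖ ^ 2 := by
        rw [← Finset.mul_sum]
        gcongr

/-- A square-function form of **von Neumann's inequality**: a family of polynomials whose square
function is bounded by `C` on the unit circle satisfies the same bound at every contraction. -/
theorem sum_norm_sq_le_of_unit_circle {H : Type*} [NormedAddCommGroup H]
    [InnerProductSpace ℝ H] {ι : Type*} (s : Finset ι) (M : ℕ) (c : ι → ℕ → ℝ) (C : ℝ)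
    (hc : ∀ z : ℂ, ‖z‖ = 1 → ∑ k ∈ s, ‖∑ i ∈ range M, (c k i : ℂ) * z ^ i‖ ^ 2 ≤ C)
    (T : H →ₗ[ℝ] H) (hT : ∀ y, ‖T y‖ ≤ ‖y‖) (x : H) :
    ∑ k ∈ s, ‖∑ i ∈ range M, c k i • (T ^ i) x‖ ^ 2 ≤ C * ‖x‖ ^ 2 := by
  have strict {r : ℝ} (hr0 : 0 ≤ r) (hr1 : r < 1) :
      ∑ k ∈ s, ‖∑ i ∈ range M, c k i • ((r • T) ^ i) x‖ ^ 2 ≤ C * ‖x‖ ^ 2 := by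
    have hS (y : H) : ‖(r • T) y‖ ≤ r * ‖y‖ := by
      rw [LinearMap.smul_apply, norm_smul, Real.norm_of_nonneg hr0]
      gcongr
      exact hT y
    have hpow (L : ℕ) (y : H) : ‖((r • T) ^ L) y‖ ≤ r ^ L * ‖y‖ := by
      induction L with
      | zero => simp
      | succ L ih =>
        rw [pow_succ', Module.End.mul_apply, pow_succ', mul_assoc]
        exact (hS _).trans (by gcongr)
    have hlim (y : H) : Filter.Tendsto (fun L ↦ ‖y‖ ^ 2 - ‖((r • T) ^ L) y‖ ^ 2)
        Filter.atTop (nhds (‖y‖ ^ 2)) := by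
      have h : Filter.Tendsto (fun L ↦ ‖((r • T) ^ L) y‖) Filter.atTop (nhds 0) := by
        refine squeeze_zero (fun L ↦ norm_nonneg _) (fun L ↦ hpow L y) ?_
        simpa using (tendsto_pow_atTop_nhds_zero_of_lt_one hr0 hr1).mul_const ‖y‖
      simpa using (h.pow 2).const_sub (‖y‖ ^ 2)
    refine le_of_tendsto' (x := Filter.atTop)
      (f := fun L ↦ ∑ k ∈ s, (‖∑ i ∈ range M, c k i • ((r • T) ^ i) x‖ ^ 2 -
        ‖((r • T) ^ L) (∑ i ∈ range M, c k i • ((r • T) ^ i) x)‖ ^ 2)) ?_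
      (sum_norm_sq_sub_norm_sq_pow_le s M c C hc (r • T) (fun y ↦ (hS y).trans
        (mul_le_of_le_one_left (norm_nonneg y) hr1.le)) x)
    exact tendsto_finsetSum _ fun k _ ↦ hlim _
  have hcont : Continuous fun r : ℝ ↦
      ∑ k ∈ s, ‖∑ i ∈ range M, c k i • ((r • T) ^ i) x‖ ^ 2 := by
    simp only [smul_pow, LinearMap.smul_apply]
    fun_prop
  have htend := (hcont.tendsto 1).mono_left (nhdsWithin_le_nhds (s := Set.Iio 1))
  simp only [one_smul] at htend
  refine le_of_tendsto htend ?_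
  filter_upwards [Ioo_mem_nhdsLT (zero_lt_one' ℝ)] with r hr
  exact strict hr.1.le hr.2

theorem norm_pow_sub_one_le {z : ℂ} (hz : ‖z‖ = 1) (n : ℕ) : ‖z ^ n - 1‖ ≤ n * ‖z - 1‖ := by
  rw [← geom_sum_mul, norm_mul]
  gcongr
  refine (norm_sum_le _ _).trans ?_
  simp [hz]

/-- On the unit circle the squared increments of the averages `(1/n) ∑_{i<n} zⁱ` are controlled by
the increments of the bounded increasing function `n ↦ nδ / (1 + nδ)`, where `δ = ‖z - 1‖`. -/
theorem norm_sq_average_sub_average_le {z : ℂ} (hz : ‖z‖ = 1) {n m : ℕ} (hn : 0 < n)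
    (hnm : n < m) :
    ‖(m : ℂ)⁻¹ * ∑ i ∈ range m, z ^ i - (n : ℂ)⁻¹ * ∑ i ∈ range n, z ^ i‖ ^ 2 ≤
      18 * (m * ‖z - 1‖ / (1 + m * ‖z - 1‖) - n * ‖z - 1‖ / (1 + n * ‖z - 1‖)) := by
  let avg (k : ℕ) : ℂ := (k : ℂ)⁻¹ * ∑ i ∈ range k, z ^ i
  change ‖avg m - avg n‖ ^ 2 ≤ _
  set δ := ‖z - 1‖
  have hδ : 0 ≤ δ := norm_nonneg _
  have hm : 0 < m := hn.trans hnm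
  have hnR : (0 : ℝ) < n := Nat.cast_pos.mpr hn
  have hmR : (0 : ℝ) < m := Nat.cast_pos.mpr hm
  have hnmR : (n : ℝ) < m := Nat.cast_lt.mpr hnm
  have mul_avg {k : ℕ} (hk : 0 < k) : (k : ℂ) * avg k = ∑ i ∈ range k, z ^ i :=
    mul_inv_cancel_left₀ (Nat.cast_ne_zero.mpr hk.ne') _
  have norm_avg {k : ℕ} (hk : 0 < k) : ‖avg k‖ ≤ 1 := by
    have h : (k : ℝ) * ‖avg k‖ ≤ k * 1 := by
      rw [← Complex.norm_natCast, ← norm_mul, mul_avg hk]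
      refine (norm_sum_le _ _).trans ?_
      simp [hz]
    exact le_of_mul_le_mul_left h (Nat.cast_pos.mpr hk)
  have decay {k : ℕ} (hk : 0 < k) : k * δ * ‖avg k‖ ≤ 2 := by
    have h : k * δ * ‖avg k‖ = ‖z ^ k - 1‖ := by
      rw [← geom_sum_mul, ← mul_avg hk, norm_mul _ (z - 1), norm_mul (k : ℂ), Complex.norm_natCast]
      ring
    rw [h]
    refine (norm_sub_le _ _).trans ?_
    simp [hz]
    norm_num
  have smooth {i : ℕ} (hi : n ≤ i) : ‖z ^ i - avg n‖ ≤ i * δ := by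
    have h : (n : ℂ) * (z ^ i - avg n) = ∑ j ∈ range n, (z ^ i - z ^ j) := by
      rw [mul_sub, mul_avg hn, Finset.sum_sub_distrib]
      simp
    have h' : (n : ℝ) * ‖z ^ i - avg n‖ ≤ n * (i * δ) := by
      rw [← Complex.norm_natCast, ← norm_mul, h, Complex.norm_natCast]
      refine (norm_sum_le_of_le (range n) (f := fun j ↦ z ^ i - z ^ j) (n := fun _ ↦ i * δ)
        fun j hj ↦ ?_).trans (by simp)
      have hji : j ≤ i := (Finset.mem_range.mp hj).le.trans hi
      have hfac : z ^ i - z ^ j = z ^ j * (z ^ (i - j) - 1) := by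
        rw [mul_sub, ← pow_add, Nat.add_sub_cancel' hji, mul_one]
      rw [hfac, norm_mul, norm_pow, hz, one_pow, one_mul]
      refine (norm_pow_sub_one_le hz _).trans ?_
      gcongr
      omega
    exact le_of_mul_le_mul_left h' hnR
  have hdiff : (m : ℂ) * (avg m - avg n) = ∑ i ∈ Ico n m, (z ^ i - avg n) := by
    rw [Finset.sum_sub_distrib, Finset.sum_Ico_eq_sub _ hnm.le, mul_sub, mul_avg hm,
      ← mul_avg hn, Finset.sum_const, Nat.card_Ico, nsmul_eq_mul, Nat.cast_sub hnm.le]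
    ring
  have increment {b : ℝ} (hb : ∀ i ∈ Ico n m, ‖z ^ i - avg n‖ ≤ b) :
      m * ‖avg m - avg n‖ ≤ (m - n) * b := by
    rw [← Complex.norm_natCast, ← norm_mul, hdiff, Complex.norm_natCast]
    refine (norm_sum_le_of_le _ hb).trans ?_
    simp [Nat.cast_sub hnm.le]
  have incr_high : m * ‖avg m - avg n‖ ≤ (m - n) * 2 := increment fun i _ ↦ by
    refine (norm_sub_le _ _).trans ?_
    rw [norm_pow, hz, one_pow]
    linarith [norm_avg hn]
  have incr_low : ‖avg m - avg n‖ ≤ (m - n) * δ := by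
    have h : m * ‖avg m - avg n‖ ≤ (m - n) * (m * δ) := increment fun i hi ↦ by
      obtain ⟨h1, h2⟩ := Finset.mem_Ico.mp hi
      exact (smooth h1).trans (by gcongr)
    refine le_of_mul_le_mul_left (h.trans_eq ?_) hmR
    ring
  have hbound : ‖avg m - avg n‖ * (1 + m * δ) ≤ 3 * ((m - n) * δ) := by
    nlinarith [mul_le_mul_of_nonneg_right incr_high hδ]
  have hsize : ‖avg m - avg n‖ * (1 + n * δ) ≤ 6 := by
    have h1 := norm_sub_le (avg m) (avg n)
    have h2 : n * δ * ‖avg m - avg n‖ ≤ n * δ * (‖avg m‖ + ‖avg n‖) := by gcongr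
    have h3 : n * δ * ‖avg m‖ ≤ m * δ * ‖avg m‖ := by gcongr
    linarith [norm_avg hn, norm_avg hm, decay hn, decay hm]
  have hdn : 0 < 1 + n * δ := by positivity
  have hdm : 0 < 1 + m * δ := by positivity
  have hpot : m * δ / (1 + m * δ) - n * δ / (1 + n * δ) =
      (m - n) * δ / ((1 + m * δ) * (1 + n * δ)) := by
    field_simp
    ring
  rw [hpot, ← mul_div_assoc, le_div_iff₀ (by positivity)]
  have := mul_le_mul hbound hsize (by positivity)
    (by have := sub_nonneg.mpr hnmR.le; positivity)
  linarith

theorem sum_norm_sq_average_sub_average_le {z : ℂ} (hz : ‖z‖ = 1) {t : ℕ → ℕ}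
    (ht : StrictMono t) (htpos : ∀ k, 0 < t k) (m : ℕ) :
    ∑ k ∈ range m, ‖(t (k + 1) : ℂ)⁻¹ * ∑ i ∈ range (t (k + 1)), z ^ i -
      (t k : ℂ)⁻¹ * ∑ i ∈ range (t k), z ^ i‖ ^ 2 ≤ 18 := by
  let f (k : ℕ) : ℝ := t k * ‖z - 1‖ / (1 + t k * ‖z - 1‖)
  have hf0 : 0 ≤ f 0 := by positivity
  have hf1 : f m ≤ 1 := div_le_one_of_le₀ (by linarith) (by positivity)
  calc _ ≤ ∑ k ∈ range m, 18 * (f (k + 1) - f k) :=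
        Finset.sum_le_sum fun k _ ↦
          norm_sq_average_sub_average_le hz (htpos k) (ht k.lt_succ_self)
    _ = 18 * (f m - f 0) := by rw [← Finset.mul_sum, Finset.sum_range_sub]
    _ ≤ 18 := by linarith

/-- Jones–Ostrovskii–Rosenblatt: for a nonexpansive linear operator `T` on a real Hilbert
space `H`, any `x ∈ H` and any strictly increasing sequence `(t k)` of positive integers,
`∑ₖ ‖A_{t(k+1)} x − A_{t k} x‖² ≤ 625 ‖x‖²` (stated via all partial sums). -/
theorem stmt2 {H : Type*} [NormedAddCommGroup H] [InnerProductSpace ℝ H] [CompleteSpace H]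
    (T : H →ₗ[ℝ] H) (hT : ∀ y : H, ‖T y‖ ≤ ‖y‖)
    (x : H) (t : ℕ → ℕ) (ht : StrictMono t) (htpos : ∀ k, 0 < t k) :
    ∀ m : ℕ,
      ∑ k ∈ Finset.range m, ‖ergAvg T (t (k + 1)) x - ergAvg T (t k) x‖ ^ 2
        ≤ 625 * ‖x‖ ^ 2 := by
  intro m
  let c (k i : ℕ) : ℝ := (if i < t (k + 1) then (t (k + 1) : ℝ)⁻¹ else 0) -
    if i < t k then (t k : ℝ)⁻¹ else 0
  have hle {k : ℕ} (hk : k ≤ m) : (range (t m)).filter (· < t k) = range (t k) := by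
    have := ht.monotone hk
    ext i
    simp only [Finset.mem_filter, Finset.mem_range]
    omega
  have hc (z : ℂ) (hz : ‖z‖ = 1) :
      ∑ k ∈ range m, ‖∑ i ∈ range (t m), (c k i : ℂ) * z ^ i‖ ^ 2 ≤ 18 := by
    refine le_of_eq_of_le (Finset.sum_congr rfl fun k hk ↦ ?_)
      (sum_norm_sq_average_sub_average_le hz ht htpos m)
    have hk := Finset.mem_range.mp hk
    congr 2
    simp only [c, Complex.ofReal_sub, apply_ite Complex.ofReal, Complex.ofReal_inv,
      Complex.ofReal_natCast, Complex.ofReal_zero, sub_mul, ite_mul, zero_mul,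
      Finset.sum_sub_distrib, ← Finset.sum_filter, hle hk.le, hle (Nat.succ_le_of_lt hk),
      Finset.mul_sum]
  have hmain := sum_norm_sq_le_of_unit_circle (range m) (t m) c 18 hc T hT x
  refine le_trans (le_of_eq (Finset.sum_congr rfl fun k hk ↦ ?_))
    (hmain.trans (by gcongr; norm_num))
  have hk := Finset.mem_range.mp hk
  congr 2
  simp only [ergAvg, c, sub_smul, ite_smul, zero_smul, Finset.sum_sub_distrib,
    ← Finset.sum_filter, hle hk.le, hle (Nat.succ_le_of_lt hk), Finset.smul_sum]
end
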